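/- arXiv:math/0006137 — 2 statements merged into one kernel-verified Lean document; each statement's English description precedes it below -/
import Mathlib

section
/- Suppose Z is a compact metric space that is uniformly perfect and doubling, and G ↷ Z is a uniformly quasi-Möbius action by homeomorphisms for which the induced action G ↷ Tri(Z) is cocompact. If the topological dimension of Z equals n ∈ ℕ, then every nonempty open subset of Z, and every nonempty open subset of any weak tangent of Z, has topological dimension equal to n. -/
open Metric Set MeasureTheory Filter Topology

noncomputable section

/-- Cross-ratio of a four-tuple of points in a metric space. -/
def crossRatio {Z : Type*} [MetricSpace Z] (z₁ z₂ z₃ z₄ : Z) : NNReal :=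
  nndist z₁ z₃ * nndist z₂ z₄ / (nndist z₁ z₄ * nndist z₂ z₃)

/-- `f : X → Y` is `η`-quasi-Möbius. -/
def IsQuasiMobius {X Y : Type*} [MetricSpace X] [MetricSpace Y]
    (η : NNReal ≃ₜ NNReal) (f : X → Y) : Prop :=
  Function.Injective f ∧
  ∀ x₁ x₂ x₃ x₄ : X, x₁ ≠ x₂ → x₁ ≠ x₃ → x₁ ≠ x₄ → x₂ ≠ x₃ → x₂ ≠ x₄ → x₃ ≠ x₄ →
    crossRatio (f x₁) (f x₂) (f x₃) (f x₄) ≤ η (crossRatio x₁ x₂ x₃ x₄)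

/-- `f : X → Y` is `η`-quasi-symmetric. -/
def IsQuasiSymmetric {X Y : Type*} [MetricSpace X] [MetricSpace Y]
    (η : NNReal ≃ₜ NNReal) (f : X → Y) : Prop :=
  Function.Injective f ∧
  ∀ x₁ x₂ x₃ : X, x₁ ≠ x₂ → x₁ ≠ x₃ → x₂ ≠ x₃ →
    nndist (f x₁) (f x₂) / nndist (f x₁) (f x₃) ≤ η (nndist x₁ x₂ / nndist x₁ x₃)

/-- Lebesgue covering dimension is at most `n`. -/
def covDimLE (X : Type*) [TopologicalSpace X] (n : ℕ) : Prop :=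
  ∀ 𝒰 : Set (Set X), (∀ U ∈ 𝒰, IsOpen U) → ⋃₀ 𝒰 = univ →
    ∃ 𝒱 : Set (Set X), (∀ V ∈ 𝒱, IsOpen V) ∧ ⋃₀ 𝒱 = univ ∧
      (∀ V ∈ 𝒱, ∃ U ∈ 𝒰, V ⊆ U) ∧
      ∀ x : X, {V ∈ 𝒱 | x ∈ V}.encard ≤ (n + 1 : ℕ)

/-- Lebesgue covering (topological) dimension. -/
noncomputable def topDim (X : Type*) [TopologicalSpace X] : ℕ∞ :=
  ⨅ (n : ℕ) (_ : covDimLE X n), (n : ℕ∞)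

/-- Ahlfors `Q`-regularity. -/
def AhlforsRegular (Q : ℝ) (Z : Type*) [MetricSpace Z] [MeasurableSpace Z] [BorelSpace Z] :
    Prop :=
  0 < Q ∧ CompleteSpace Z ∧ 0 < Metric.diam (univ : Set Z) ∧
  ∃ C : ℝ, 1 ≤ C ∧ ∀ (z : Z) (R : ℝ), 0 < R → R ≤ Metric.diam (univ : Set Z) →
    ENNReal.ofReal (R ^ Q / C) ≤ μH[Q] (Metric.ball z R) ∧
    μH[Q] (Metric.ball z R) ≤ ENNReal.ofReal (C * R ^ Q)

/-- The action of `G` on `Z` is by homeomorphisms, each `η`-quasi-Möbius. -/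
def QMAction (η : NNReal ≃ₜ NNReal) (G Z : Type*) [Group G] [MulAction G Z]
    [MetricSpace Z] : Prop :=
  (∀ g : G, Continuous fun z : Z => g • z) ∧
  ∀ g : G, IsQuasiMobius η (fun z : Z => g • z)

/-- Cocompactness of the induced action on distinct triples (for compact `Z`). -/
def TriplesCocompact (G Z : Type*) [Group G] [MulAction G Z] [MetricSpace Z] : Prop :=
  ∃ δ > (0:ℝ), ∀ z₁ z₂ z₃ : Z, z₁ ≠ z₂ → z₁ ≠ z₃ → z₂ ≠ z₃ →
    ∃ g : G, δ ≤ dist (g • z₁) (g • z₂) ∧ δ ≤ dist (g • z₁) (g • z₃) ∧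
      δ ≤ dist (g • z₂) (g • z₃)

def IsStableValue {X Y : Type*} [TopologicalSpace X] [MetricSpace Y]
    (f : X → Y) (y : Y) : Prop :=
  ∃ ε > (0:ℝ), ∀ g : X → Y, Continuous g → (∀ x, dist (f x) (g x) < ε) → y ∈ range g

def IsStableValueOn {X Y : Type*} [TopologicalSpace X] [MetricSpace Y]
    (f : X → Y) (s : Set X) (y : Y) : Prop :=
  IsStableValue (fun x : s => f x) y

def IsStablePoint {X Y : Type*} [TopologicalSpace X] [MetricSpace Y]
    (f : X → Y) (x : X) : Prop :=
  ∀ U ∈ nhds x, IsStableValueOn f U (f x)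

/-- `f` is a regular map. -/
def IsRegularMap {X Y : Type*} [MetricSpace X] [MetricSpace Y] (f : X → Y) : Prop :=
  (∃ L : NNReal, LipschitzWith L f) ∧
  ∃ N : ℕ, ∀ (y : Y) (r : ℝ), 0 < r → ∃ t : Finset X, t.card ≤ N ∧
    f ⁻¹' Metric.ball y r ⊆ ⋃ c ∈ t, Metric.ball c r

/-- A metric space is doubling. -/
def MetricDoubling (Y : Type*) [MetricSpace Y] : Prop :=
  ∃ M : ℕ, ∀ (y : Y) (R : ℝ), ∃ t : Finset Y, t.card ≤ M ∧
    Metric.ball y R ⊆ ⋃ c ∈ t, Metric.ball c (R / 2)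

/-- A metric space is uniformly perfect. -/
def UniformlyPerfect (Z : Type*) [MetricSpace Z] : Prop :=
  ∃ lam : ℝ, 1 ≤ lam ∧ ∀ (z : Z) (R : ℝ), 0 < R → R ≤ Metric.diam (univ : Set Z) →
    (Metric.closedBall z R \ Metric.ball z (R / lam)).Nonempty

/-- `(S, q)` is a weak tangent of `Z`: `S` is complete and some rescalings
`(λ_k Z, p_k)` converge to `(S, q)` in the pointed Gromov–Hausdorff sense. -/
def PointedWeakTangent (Z : Type*) [MetricSpace Z] (S : Type*) [MetricSpace S]
    (q : S) : Prop :=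
  CompleteSpace S ∧
  ∃ (lam : ℕ → ℝ) (p : ℕ → Z), (∀ k, 0 < lam k) ∧ Tendsto lam atTop atTop ∧
    ∀ R > (0:ℝ), ∀ ε > (0:ℝ), ∃ (N : ℕ) (M : Set S),
      q ∈ M ∧ M ⊆ Metric.ball q R ∧ (∀ s ∈ Metric.ball q R, ∃ m ∈ M, dist s m ≤ ε) ∧
      ∀ k ≥ N, ∃ (Mk : Set Z) (F : Z → S),
        p k ∈ Mk ∧ (∀ z ∈ Mk, lam k * dist z (p k) < R) ∧
        (∀ z : Z, lam k * dist z (p k) < R → ∃ w ∈ Mk, lam k * dist z w ≤ ε) ∧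
        F (p k) = q ∧ Set.BijOn F Mk M ∧
        ∀ a ∈ Mk, ∀ b ∈ Mk, |lam k * dist a b - dist (F a) (F b)| < ε

section CoveringDimension

/-- An indexed open cover of a space of covering dimension at most `m` has an indexed open
shrinking of order at most `m + 1`. -/
lemma covDimLE.exists_shrinking {X I : Type*} [TopologicalSpace X] {m : ℕ} (h : covDimLE X m)
    (U : I → Set X) (hU : ∀ i, IsOpen (U i)) (hc : ⋃ i, U i = univ) :
    ∃ V : I → Set X, (∀ i, IsOpen (V i)) ∧ (⋃ i, V i = univ) ∧ (∀ i, V i ⊆ U i) ∧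
      ∀ x, {i | x ∈ V i}.encard ≤ (m + 1 : ℕ) := by
  obtain ⟨𝒱, hVo, hVc, hVU, hVn⟩ := h (range U) (by rintro _ ⟨i, rfl⟩; exact hU i)
    (by rw [sUnion_range, hc])
  have hidx : ∀ V : 𝒱, ∃ i, (V : Set X) ⊆ U i := by
    rintro ⟨V, hV⟩
    obtain ⟨_, ⟨i, rfl⟩, hi⟩ := hVU V hV
    exact ⟨i, hi⟩
  choose c hcU using hidx
  refine ⟨fun i => ⋃ V : {V : 𝒱 // c V = i}, (V : Set X), fun i => ?_, ?_, fun i => ?_,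
    fun x => ?_⟩
  · exact isOpen_iUnion fun V => hVo _ V.1.2
  · refine eq_univ_of_forall fun x => ?_
    obtain ⟨V, hV, hx⟩ : x ∈ ⋃₀ 𝒱 := hVc ▸ mem_univ x
    exact mem_iUnion.2 ⟨c ⟨V, hV⟩, mem_iUnion.2 ⟨⟨⟨V, hV⟩, rfl⟩, hx⟩⟩
  · refine iUnion_subset fun V => ?_
    have := hcU V.1
    rwa [V.2] at this
  · have hsub : {i | x ∈ ⋃ V : {V : 𝒱 // c V = i}, (V : Set X)} ⊆
        c '' {V : 𝒱 | x ∈ (V : Set X)} := by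
      intro i hi
      obtain ⟨V, hV⟩ := mem_iUnion.1 hi
      exact ⟨V.1, hV, V.2⟩
    refine (encard_le_encard hsub).trans ((encard_image_le _ _).trans ?_)
    refine le_trans ?_ (hVn x)
    rw [← Subtype.val_injective.encard_image]
    refine encard_le_encard ?_
    rintro _ ⟨V, hV, rfl⟩
    exact ⟨V.2, hV⟩

/-- To bound the covering dimension it suffices to shrink indexed open covers. -/
lemma covDimLE_of_shrinking {X : Type*} [TopologicalSpace X] {m : ℕ}
    (h : ∀ 𝒰 : Set (Set X), ∀ U : 𝒰 → Set X, (∀ i, IsOpen (U i)) → ⋃ i, U i = univ →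
      ∃ V : 𝒰 → Set X, (∀ i, IsOpen (V i)) ∧ (⋃ i, V i = univ) ∧ (∀ i, V i ⊆ U i) ∧
        ∀ x, {i | x ∈ V i}.encard ≤ (m + 1 : ℕ)) : covDimLE X m := by
  intro 𝒰 hUo hUc
  obtain ⟨V, hVo, hVc, hVU, hVn⟩ := h 𝒰 (fun i => i) (fun i => hUo i i.2)
    (by rw [← sUnion_eq_iUnion, hUc])
  refine ⟨range V, by rintro _ ⟨i, rfl⟩; exact hVo i, by rw [sUnion_range, hVc], ?_, fun x => ?_⟩
  · rintro _ ⟨i, rfl⟩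
    exact ⟨i, i.2, hVU i⟩
  · have hsub : {W ∈ range V | x ∈ W} ⊆ V '' {i | x ∈ V i} := by
      rintro _ ⟨⟨i, rfl⟩, hi⟩
      exact ⟨i, hi, rfl⟩
    exact (encard_le_encard hsub).trans ((encard_image_le _ _).trans (hVn x))

lemma covDimLE.of_isClosedEmbedding {X Y : Type*} [TopologicalSpace X] [TopologicalSpace Y]
    {m : ℕ} (h : covDimLE Y m) {f : X → Y} (hf : IsClosedEmbedding f) : covDimLE X m := by
  refine covDimLE_of_shrinking fun 𝒰 U hUo hUc => ?_
  have hO : ∀ i, ∃ O, IsOpen O ∧ f ⁻¹' O = U i := fun i => hf.isInducing.isOpen_iff.1 (hUo i)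
  choose O hOo hOU using hO
  obtain ⟨V, hVo, hVc, hVO, hVn⟩ := h.exists_shrinking
    (fun i : Option 𝒰 => i.elim (range f)ᶜ O)
    (by rintro (_ | i); exacts [hf.isClosed_range.isOpen_compl, hOo i]) (by
      refine eq_univ_of_forall fun y => mem_iUnion.2 ?_
      by_cases hy : y ∈ range f
      · obtain ⟨x, rfl⟩ := hy
        obtain ⟨i, hi⟩ := mem_iUnion.1 (hUc ▸ mem_univ x : x ∈ ⋃ i, U i)
        rw [← hOU] at hi
        exact ⟨some i, hi⟩
      · exact ⟨none, hy⟩)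
  refine ⟨fun i => f ⁻¹' V (some i), fun i => (hVo _).preimage hf.continuous, ?_, fun i => ?_,
    fun x => ?_⟩
  · refine eq_univ_of_forall fun x => mem_iUnion.2 ?_
    obtain ⟨i, hi⟩ := mem_iUnion.1 (hVc ▸ mem_univ (f x) : f x ∈ ⋃ i, V i)
    rcases i with _ | i
    · exact absurd (mem_range_self x) (hVO none hi)
    · exact ⟨i, hi⟩
  · rw [← hOU]
    exact preimage_mono (hVO (some i))
  · refine le_trans ?_ (hVn (f x))
    rw [← (Option.some_injective 𝒰).encard_image]
    refine encard_le_encard ?_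
    rintro _ ⟨i, hi, rfl⟩
    exact hi

/-- An indexed open cover can be shrunk so as to have order at most `m + 1` along a locally
finite disjoint union of closed sets of covering dimension at most `m`. -/
lemma exists_shrinking_along_closed {X I J : Type*} [TopologicalSpace X] {m : ℕ}
    (A : J → Set X) (hA : ∀ j, IsClosed (A j)) (hlf : LocallyFinite A)
    (hdisj : ∀ j j', j ≠ j' → Disjoint (A j) (A j')) (hdim : ∀ j, covDimLE (A j) m)
    (U : I → Set X) (hU : ∀ i, IsOpen (U i)) (hc : ⋃ i, U i = univ) :
    ∃ V : I → Set X, (∀ i, IsOpen (V i)) ∧ (⋃ i, V i = univ) ∧ (∀ i, V i ⊆ U i) ∧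
      ∀ x ∈ ⋃ j, A j, {i | x ∈ V i}.encard ≤ (m + 1 : ℕ) := by
  have key : ∀ j, ∃ V : I → Set (A j), (∀ i, IsOpen (V i)) ∧ (⋃ i, V i = univ) ∧
      (∀ i, V i ⊆ Subtype.val ⁻¹' U i) ∧ ∀ x, {i | x ∈ V i}.encard ≤ (m + 1 : ℕ) := fun j =>
    (hdim j).exists_shrinking (fun i => Subtype.val ⁻¹' U i)
      (fun i => (hU i).preimage continuous_subtype_val) (by rw [← preimage_iUnion, hc, preimage_univ])
  choose W hWo hWc hWU hWn using key
  have hclosed : ∀ i, IsClosed (⋃ j, (Subtype.val '' (W j i)ᶜ : Set X)) := fun i =>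
    (hlf.subset fun j => by rintro _ ⟨x, -, rfl⟩; exact x.2).isClosed_iUnion fun j =>
      (hA j).isClosedEmbedding_subtypeVal.isClosedMap _ (hWo j i).isClosed_compl
  refine ⟨fun i => U i \ ⋃ j, Subtype.val '' (W j i)ᶜ, fun i => (hU i).sdiff (hclosed i), ?_,
    fun i => sdiff_subset, fun x hx => ?_⟩
  · refine eq_univ_of_forall fun x => mem_iUnion.2 ?_
    by_cases hx : x ∈ ⋃ j, A j
    · obtain ⟨j, hj⟩ := mem_iUnion.1 hx
      obtain ⟨i, hi⟩ := mem_iUnion.1 (hWc j ▸ mem_univ (⟨x, hj⟩ : A j) : _ ∈ ⋃ i, W j i)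
      refine ⟨i, hWU j i hi, fun hmem => ?_⟩
      obtain ⟨j', ⟨x', hx'⟩, hn, rfl⟩ := mem_iUnion.1 hmem
      by_cases hjj : j = j'
      · subst hjj
        exact hn hi
      · exact disjoint_left.1 (hdisj j j' hjj) hj hx'
    · obtain ⟨i, hi⟩ := mem_iUnion.1 (hc ▸ mem_univ x : x ∈ ⋃ i, U i)
      refine ⟨i, hi, fun hmem => hx ?_⟩
      obtain ⟨j, x', -, rfl⟩ := mem_iUnion.1 hmem
      exact mem_iUnion.2 ⟨j, x'.2⟩
  · obtain ⟨j, hj⟩ := mem_iUnion.1 hx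
    refine (encard_le_encard ?_).trans (hWn j ⟨x, hj⟩)
    intro i hi
    by_contra hni
    exact hi.2 (mem_iUnion.2 ⟨j, ⟨x, hj⟩, hni, rfl⟩)

/-- Removing arbitrarily small neighbourhoods of one point does not lower the dimension. -/
lemma covDimLE_of_forall_compl_ball {X : Type*} [MetricSpace X] {m : ℕ} (y : X)
    (h : ∀ ρ > 0, covDimLE {x : X | ρ ≤ dist x y} m) : covDimLE X m := by
  classical
  refine covDimLE_of_shrinking fun 𝒰 U hUo hUc => ?_
  obtain ⟨i₀, hi₀⟩ := mem_iUnion.1 (hUc ▸ mem_univ y : y ∈ ⋃ i, U i)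
  obtain ⟨ρ, hρ, hball⟩ := Metric.nhds_basis_closedBall.mem_iff.1 ((hUo i₀).mem_nhds hi₀)
  obtain ⟨V, hVo, hVc, hVU, hVn⟩ := exists_shrinking_along_closed (m := m)
    (fun _ : Unit => {x : X | ρ ≤ dist x y})
    (fun _ => isClosed_le continuous_const (continuous_id.dist continuous_const))
    (locallyFinite_of_finite _) (fun j j' hj => absurd (Subsingleton.elim j j') hj)
    (fun _ => h ρ hρ) (fun i => if i = i₀ then U i else U i \ closedBall y ρ)
    (fun i => by split_ifs; exacts [hUo i, (hUo i).sdiff isClosed_closedBall]) (by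
      refine eq_univ_of_forall fun x => mem_iUnion.2 ?_
      by_cases hx : x ∈ closedBall y ρ
      · exact ⟨i₀, by simpa using hball hx⟩
      · obtain ⟨i, hi⟩ := mem_iUnion.1 (hUc ▸ mem_univ x : x ∈ ⋃ i, U i)
        refine ⟨i, ?_⟩
        split_ifs
        exacts [hi, ⟨hi, hx⟩])
  refine ⟨V, hVo, hVc, fun i => (hVU i).trans (by split_ifs; exacts [subset_rfl, sdiff_subset]),
    fun x => ?_⟩
  by_cases hx : ρ ≤ dist x y
  · exact hVn x (mem_iUnion.2 ⟨(), hx⟩)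
  · have hsub : {i | x ∈ V i} ⊆ {i₀} := by
      intro i hi
      by_contra hne
      have := hVU i hi
      rw [if_neg (by simpa using hne)] at this
      exact this.2 (mem_closedBall.2 (not_le.1 hx).le)
    refine (encard_le_encard hsub).trans ?_
    rw [encard_singleton]
    exact_mod_cast Nat.le_add_left 1 m

/-- The covering dimension of an open subset of a metric space does not exceed that of the
space. -/
lemma covDimLE.of_isOpen {X : Type*} [MetricSpace X] {m : ℕ} (h : covDimLE X m) {U : Set X}
    (hU : IsOpen U) : covDimLE U m := by
  by_cases huniv : U = univ
  · subst huniv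
    exact h.of_isClosedEmbedding isClosed_univ.isClosedEmbedding_subtypeVal
  have hne : Uᶜ.Nonempty := nonempty_compl.2 huniv
  have hpos : ∀ x : U, 0 < infDist (x : X) Uᶜ := fun x =>
    (hU.isClosed_compl.notMem_iff_infDist_pos hne).1 (fun hx => hx x.2)
  let t : U → ℝ := fun x => (infDist (x : X) Uᶜ)⁻¹
  have ht : Continuous t :=
    ((continuous_infDist_pt _).comp continuous_subtype_val).inv₀ fun x => (hpos x).ne'
  have hinv : ∀ (a : ℝ) (x : U), a ≤ t x ↔ a * infDist (x : X) Uᶜ ≤ 1 := fun a x => by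
    rw [← le_div_iff₀ (hpos x), one_div]
  have hslab : ∀ a b : ℝ, covDimLE (t ⁻¹' Icc a b) m := fun a b => by
    refine h.of_isClosedEmbedding (f := fun x => ((x : U) : X))
      ⟨IsEmbedding.subtypeVal.comp IsEmbedding.subtypeVal, ?_⟩
    have hrange : range (fun x : t ⁻¹' Icc a b => ((x : U) : X)) =
        {x | a * infDist x Uᶜ ≤ 1} ∩ {x | 1 ≤ b * infDist x Uᶜ} := by
      ext x
      constructor
      · rintro ⟨⟨x, hx⟩, rfl⟩
        exact ⟨(hinv a x).1 hx.1, (inv_le_iff_one_le_mul₀ (hpos x)).1 hx.2⟩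
      · rintro ⟨hxa, hxb⟩
        have hxU : x ∈ U := by
          by_contra hx
          have hxb' : 1 ≤ b * infDist x Uᶜ := hxb
          rw [infDist_zero_of_mem (show x ∈ Uᶜ from hx)] at hxb'
          linarith
        exact ⟨⟨⟨x, hxU⟩, (hinv a ⟨x, hxU⟩).2 hxa,
          (inv_le_iff_one_le_mul₀ (hpos ⟨x, hxU⟩)).2 hxb⟩, rfl⟩
    rw [hrange]
    exact (isClosed_le (continuous_const.mul (continuous_infDist_pt _)) continuous_const).inter
      (isClosed_le continuous_const (continuous_const.mul (continuous_infDist_pt _)))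
  have hshrink : ∀ (c : ℝ) {I : Type _} (W : I → Set U), (∀ i, IsOpen (W i)) → ⋃ i, W i = univ →
      ∃ V : I → Set U, (∀ i, IsOpen (V i)) ∧ (⋃ i, V i = univ) ∧ (∀ i, V i ⊆ W i) ∧
        ∀ x ∈ ⋃ j : ℤ, t ⁻¹' Icc (2 * j + c) (2 * j + c + 1),
          {i | x ∈ V i}.encard ≤ (m + 1 : ℕ) := fun c I W hWo hWc => by
    refine exists_shrinking_along_closed (fun j : ℤ => t ⁻¹' Icc (2 * j + c) (2 * j + c + 1))
      (fun j => isClosed_Icc.preimage ht) ?_ (fun j j' hj => ?_) (fun j => hslab _ _) W hWo hWc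
    · refine LocallyFinite.preimage_continuous (locallyFinite_Icc_of_tendsto ?_ ?_) ht
      · exact tendsto_atTop_add_const_right _ _
          (tendsto_intCast_atTop_atTop.const_mul_atTop two_pos)
      · exact tendsto_atBot_add_const_right _ _ (tendsto_atBot_add_const_right _ _
          ((tendsto_intCast_atBot_iff.2 tendsto_id).const_mul_atBot two_pos))
    · refine Disjoint.preimage _ (disjoint_left.2 fun r hr hr' => hj ?_)
      have h₁ : (2 * j : ℝ) < 2 * j' + 2 := by linarith [hr.1, hr'.2]
      have h₂ : (2 * j' : ℝ) < 2 * j + 2 := by linarith [hr'.1, hr.2]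
      have h₁' : 2 * j < 2 * j' + 2 := by exact_mod_cast h₁
      have h₂' : 2 * j' < 2 * j + 2 := by exact_mod_cast h₂
      omega
  refine covDimLE_of_shrinking fun 𝒰 W hWo hWc => ?_
  obtain ⟨V, hVo, hVc, hVW, hVn⟩ := hshrink 0 W hWo hWc
  obtain ⟨V', hVo', hVc', hVV, hVn'⟩ := hshrink 1 V hVo hVc
  refine ⟨V', hVo', hVc', fun i => (hVV i).trans (hVW i), fun x => ?_⟩
  have hlow := Int.floor_le (t x)
  have hupp := (Int.lt_floor_add_one (t x)).le
  rcases Int.even_or_odd' ⌊t x⌋ with ⟨j, hj | hj⟩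
  · rw [hj] at hlow hupp
    push_cast at hlow hupp
    refine (encard_le_encard fun i hi => hVV i hi).trans (hVn x (mem_iUnion.2 ⟨j, ?_, ?_⟩)) <;>
      linarith
  · rw [hj] at hlow hupp
    push_cast at hlow hupp
    exact hVn' x (mem_iUnion.2 ⟨j, hlow, hupp⟩)

lemma covDimLE_of_subsingleton {X : Type*} [TopologicalSpace X] [Subsingleton X] (m : ℕ) :
    covDimLE X m := by
  refine covDimLE_of_shrinking fun 𝒰 U hUo hUc => ?_
  rcases isEmpty_or_nonempty X with hX | ⟨⟨x₀⟩⟩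
  · exact ⟨U, hUo, hUc, fun _ => subset_rfl, isEmptyElim⟩
  obtain ⟨i₀, hi₀⟩ := mem_iUnion.1 (hUc ▸ mem_univ x₀ : x₀ ∈ ⋃ i, U i)
  refine ⟨fun i => {x | i = i₀}, fun i => isOpen_discrete _, ?_, ?_, fun x => ?_⟩
  · exact eq_univ_of_forall fun x => mem_iUnion.2 ⟨i₀, rfl⟩
  · rintro _ x rfl
    rwa [Subsingleton.elim x x₀]
  · refine (encard_le_encard (t := {i₀}) fun i hi => hi).trans ?_
    rw [encard_singleton]
    exact_mod_cast Nat.le_add_left 1 m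

lemma topDim_congr {X Y : Type*} [TopologicalSpace X] [TopologicalSpace Y]
    (h : ∀ m, covDimLE X m ↔ covDimLE Y m) : topDim X = topDim Y := by
  simp only [topDim, h]

end CoveringDimension

section QuasiMobius

/-- The extension of a distortion function to the real line. -/
def realDistortion (η : NNReal ≃ₜ NNReal) (t : ℝ) : ℝ := η t.toNNReal

variable (η : NNReal ≃ₜ NNReal)

lemma realDistortion_nonneg (t : ℝ) : 0 ≤ realDistortion η t := NNReal.coe_nonneg _

lemma continuous_realDistortion : Continuous (realDistortion η) :=
  NNReal.continuous_coe.comp (η.continuous.comp continuous_real_toNNReal)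

lemma strictMono_distortion : StrictMono η := by
  rcases η.continuous.strictMono_of_inj η.injective with h | h
  · exact h
  · obtain ⟨x, hx⟩ := η.surjective (η 0 + 1)
    have := h.antitone (zero_le (a := x))
    rw [hx] at this
    exact absurd (lt_add_one (η 0)) (not_lt.2 this)

lemma monotone_realDistortion : Monotone (realDistortion η) := fun _ _ h =>
  NNReal.coe_le_coe.2 ((strictMono_distortion η).monotone (Real.toNNReal_mono h))

lemma realDistortion_zero : realDistortion η 0 = 0 := by
  obtain ⟨x, hx⟩ := η.surjective 0
  have := (strictMono_distortion η).monotone (zero_le (a := x))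
  rw [hx] at this
  simpa [realDistortion] using this

variable {η} {Z : Type*} [MetricSpace Z]

/-- The quasi-Möbius inequality with real distances and cleared denominators. -/
lemma IsQuasiMobius.dist_mul_dist_le {f : Z → Z} (hf : IsQuasiMobius η f) {x₁ x₂ x₃ x₄ : Z}
    (h₁₂ : x₁ ≠ x₂) (h₁₄ : x₁ ≠ x₄) (h₂₃ : x₂ ≠ x₃) (h₃₄ : x₃ ≠ x₄) :
    dist (f x₁) (f x₃) * dist (f x₂) (f x₄) ≤
      realDistortion η (dist x₁ x₃ * dist x₂ x₄ / (dist x₁ x₄ * dist x₂ x₃)) *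
        (dist (f x₁) (f x₄) * dist (f x₂) (f x₃)) := by
  have hR : 0 ≤ realDistortion η (dist x₁ x₃ * dist x₂ x₄ / (dist x₁ x₄ * dist x₂ x₃)) *
      (dist (f x₁) (f x₄) * dist (f x₂) (f x₃)) :=
    mul_nonneg (realDistortion_nonneg η _) (by positivity)
  by_cases h₁₃ : x₁ = x₃
  · simpa [h₁₃] using hR
  by_cases h₂₄ : x₂ = x₄
  · simpa [h₂₄] using hR
  have h := NNReal.coe_le_coe.2 (hf.2 x₁ x₂ x₃ x₄ h₁₂ h₁₃ h₁₄ h₂₃ h₂₄ h₃₄)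
  rw [← div_le_iff₀ (mul_pos (dist_pos.2 (hf.1.ne h₁₄)) (dist_pos.2 (hf.1.ne h₂₃)))]
  have hc : (dist x₁ x₃ * dist x₂ x₄ / (dist x₁ x₄ * dist x₂ x₃)).toNNReal =
      crossRatio x₁ x₂ x₃ x₄ := by
    rw [← Real.toNNReal_coe (r := crossRatio x₁ x₂ x₃ x₄)]
    simp [crossRatio]
  rw [realDistortion, hc]
  simpa [crossRatio] using h

variable {G : Type*} [Group G] [MulAction G Z]

lemma IsQuasiMobius.dist_mul_dist_le_of_smul (hqm : ∀ g : G, IsQuasiMobius η (fun z : Z => g • z))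
    (g : G) {x₁ x₂ x₃ x₄ : Z}
    (h₁₂ : x₁ ≠ x₂) (h₁₄ : x₁ ≠ x₄) (h₂₃ : x₂ ≠ x₃) (h₃₄ : x₃ ≠ x₄) :
    dist x₁ x₃ * dist x₂ x₄ ≤
      realDistortion η (dist (g • x₁) (g • x₃) * dist (g • x₂) (g • x₄) /
        (dist (g • x₁) (g • x₄) * dist (g • x₂) (g • x₃))) * (dist x₁ x₄ * dist x₂ x₃) := by
  have hinj := MulAction.injective (β := Z) g
  simpa using (hqm g⁻¹).dist_mul_dist_le (hinj.ne h₁₂) (hinj.ne h₁₄) (hinj.ne h₂₃) (hinj.ne h₃₄)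

lemma exists_tendsto_of_ultrafilter [CompactSpace Z] (L : Ultrafilter ℕ) (u : ℕ → Z) :
    ∃ x, Tendsto u L (𝓝 x) :=
  ⟨_, (L.map u).le_nhds_lim⟩

lemma dist_le_diam_univ [CompactSpace Z] (x y : Z) : dist x y ≤ diam (univ : Set Z) :=
  dist_le_diam_of_mem isCompact_univ.isBounded (mem_univ x) (mem_univ y)

lemma diam_univ_pos [CompactSpace Z] [Nontrivial Z] : 0 < diam (univ : Set Z) := by
  obtain ⟨x, y, hxy⟩ := exists_pair_ne Z
  exact (dist_pos.2 hxy).trans_le (dist_le_diam_univ x y)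

lemma UniformlyPerfect.exists_dist_lt [CompactSpace Z] [Nontrivial Z] (hup : UniformlyPerfect Z)
    (z : Z) {r : ℝ} (hr : 0 < r) : ∃ x, x ≠ z ∧ dist x z < r := by
  obtain ⟨l, hl, h⟩ := hup
  have hR : 0 < min (r / 2) (diam (univ : Set Z)) := lt_min (by positivity) diam_univ_pos
  obtain ⟨x, hx, hx'⟩ := h z _ hR (min_le_right _ _)
  refine ⟨x, fun hxz => hx' ?_, ?_⟩
  · rw [hxz]
    exact mem_ball_self (by positivity)
  · have := (mem_closedBall.1 hx).trans (min_le_left _ _)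
    linarith

/-- Group elements expand any neighbourhood of `z` to the complement of an arbitrarily small
ball around a fixed point. -/
lemma exists_expanding_center [CompactSpace Z] [Nontrivial Z] (hup : UniformlyPerfect Z)
    (hqm : ∀ g : G, IsQuasiMobius η (fun z : Z => g • z)) (hcc : TriplesCocompact G Z) (z : Z)
    {ε : ℝ} (hε : 0 < ε) :
    ∃ y₀ : Z, ∀ ρ > 0, ∃ g : G, ∀ w, ε ≤ dist w z → dist (g • w) y₀ < ρ := by
  obtain ⟨δ, hδ, hcc⟩ := hcc
  obtain ⟨y, hy⟩ := exists_ne z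
  have hyz : 0 < dist z y := dist_pos.2 hy.symm
  set D := diam (univ : Set Z) with hD
  have hDpos : 0 < D := diam_univ_pos
  have hx : ∀ k : ℕ, ∃ x, x ≠ z ∧ dist x z < min (min (ε / 2) (dist z y)) (1 / ((k : ℝ) + 1)) :=
    fun k => hup.exists_dist_lt z (lt_min (lt_min (by positivity) hyz) (by positivity))
  choose x hxz hx using hx
  have hxε : ∀ k, dist (x k) z < ε / 2 := fun k =>
    (hx k).trans_le ((min_le_left _ _).trans (min_le_left _ _))
  have hxy : ∀ k, x k ≠ y := fun k h => by
    have := (hx k).trans_le ((min_le_left _ _).trans (min_le_right _ _))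
    rw [h, dist_comm] at this
    exact lt_irrefl _ this
  have hx0 : Tendsto (fun k => dist z (x k)) atTop (𝓝 0) :=
    squeeze_zero (fun _ => dist_nonneg)
      (fun k => by rw [dist_comm]; exact ((hx k).trans_le (min_le_right _ _)).le)
      tendsto_one_div_add_atTop_nhds_zero_nat
  choose g hg₁ hg₂ hg₃ using fun k => hcc z (x k) y (hxz k).symm hy.symm (hxy k)
  obtain ⟨y₀, hy₀⟩ := exists_tendsto_of_ultrafilter (hyperfilter ℕ) fun k => g k • y
  refine ⟨y₀, fun ρ hρ => ?_⟩
  have hbound : Tendsto (fun k => realDistortion η (D * dist z (x k) / (ε / 2 * dist z y)) *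
      (D * D) / δ) (hyperfilter ℕ : Filter ℕ) (𝓝 0) := by
    have h0 : Tendsto (fun k => D * dist z (x k) / (ε / 2 * dist z y)) atTop (𝓝 0) := by
      simpa using (hx0.const_mul D).div_const (ε / 2 * dist z y)
    have := (((continuous_realDistortion η).tendsto 0).comp h0).mul_const (D * D) |>.div_const δ
    rw [realDistortion_zero, zero_mul, zero_div] at this
    exact this.mono_left (Nat.hyperfilter_le_atTop)
  obtain ⟨k, hk₁, hk₂⟩ := ((hbound.eventually_lt_const (half_pos hρ)).and
    ((Metric.tendsto_nhds.1 hy₀) _ (half_pos hρ))).exists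
  refine ⟨g k, fun w hw => ?_⟩
  have hwx : ε / 2 ≤ dist w (x k) := by
    linarith [dist_triangle w (x k) z, hxε k]
  have hwy : dist (g k • w) (g k • y) ≤
      realDistortion η (D * dist z (x k) / (ε / 2 * dist z y)) * (D * D) / δ := by
    by_cases h : w = y
    · rw [h, dist_self]
      exact div_nonneg (mul_nonneg (realDistortion_nonneg η _) (by positivity)) hδ.le
    have hwz : w ≠ z := dist_pos.1 (hε.trans_le hw)
    have hwx' : w ≠ x k := dist_pos.1 ((half_pos hε).trans_le hwx)
    have hmain := (hqm (g k)).dist_mul_dist_le hwz hwx' hy.symm (hxy k).symm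
    rw [le_div_iff₀ hδ]
    calc dist (g k • w) (g k • y) * δ
        ≤ dist (g k • w) (g k • y) * dist (g k • z) (g k • x k) := by
          gcongr
          exact hg₁ k
      _ ≤ _ := hmain
      _ ≤ _ := by
          refine mul_le_mul (monotone_realDistortion η ?_) ?_ (by positivity)
            (realDistortion_nonneg η _)
          · gcongr
            exact dist_le_diam_univ _ _
          · gcongr <;> exact dist_le_diam_univ _ _
  linarith [dist_triangle (g k • w) (g k • y) y₀]

lemma covDimLE_of_isOpen_subset [CompactSpace Z] [Nontrivial Z] (hup : UniformlyPerfect Z)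
    (hcont : ∀ g : G, Continuous fun z : Z => g • z)
    (hqm : ∀ g : G, IsQuasiMobius η (fun z : Z => g • z)) (hcc : TriplesCocompact G Z)
    {U : Set Z} (hU : IsOpen U) (hne : U.Nonempty) {m : ℕ} (h : covDimLE U m) :
    covDimLE Z m := by
  obtain ⟨z, hz⟩ := hne
  obtain ⟨ε, hε, hball⟩ := Metric.isOpen_iff.1 hU z hz
  obtain ⟨y₀, hy₀⟩ := exists_expanding_center hup hqm hcc z hε
  refine covDimLE_of_forall_compl_ball y₀ fun ρ hρ => ?_
  obtain ⟨g, hg⟩ := hy₀ ρ hρ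
  have hmem : ∀ x : {x : Z | ρ ≤ dist x y₀}, g⁻¹ • (x : Z) ∈ U := fun x => by
    refine hball (mem_ball.2 (not_le.1 fun hle => ?_))
    have := hg _ hle
    rw [smul_inv_smul] at this
    exact absurd x.2 (not_le.2 this)
  have hcl : IsClosed {x : Z | ρ ≤ dist x y₀} :=
    isClosed_le continuous_const (continuous_id.dist continuous_const)
  have : CompactSpace {x : Z | ρ ≤ dist x y₀} := isCompact_iff_compactSpace.1 hcl.isCompact
  refine h.of_isClosedEmbedding (f := fun x => ⟨g⁻¹ • (x : Z), hmem x⟩)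
    (Continuous.isClosedEmbedding ?_ fun x x' hxx => ?_)
  · exact ((hcont g⁻¹).comp continuous_subtype_val).subtype_mk _
  · exact Subtype.ext (MulAction.injective g⁻¹ (congrArg Subtype.val hxx))

end QuasiMobius

section WeakTangent

variable {Z : Type*} [MetricSpace Z] {S : Type*} [MetricSpace S] {q : S}

lemma exists_approximate_inverse {M : Set S} {N : Set Z} {F : Z → S} {p : Z} {R ε l : ℝ}
    (hR : 0 < R) (hl : 0 < l) (hMR : M ⊆ ball q R) (hMd : ∀ s ∈ ball q R, ∃ m ∈ M, dist s m ≤ ε)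
    (hp : p ∈ N) (hNd : ∀ z : Z, l * dist z p < R → ∃ w ∈ N, l * dist z w ≤ ε) (hFp : F p = q)
    (hF : BijOn F N M) (hFd : ∀ a ∈ N, ∀ b ∈ N, |l * dist a b - dist (F a) (F b)| < ε) :
    ∃ φ : S → Z, (∀ s ∈ ball q R, ∀ t ∈ ball q R,
        |l * dist (φ s) (φ t) - dist s t| ≤ 3 * ε) ∧
      ∀ z, l * dist z (φ q) < R - 2 * ε → ∃ s ∈ ball q R, l * dist z (φ s) ≤ 3 * ε := by
  have hφ : ∀ s, ∃ w, s ∈ ball q R → w ∈ N ∧ dist s (F w) ≤ ε := fun s => by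
    by_cases hs : s ∈ ball q R
    · obtain ⟨m, hm, hsm⟩ := hMd s hs
      obtain ⟨w, hw, rfl⟩ := hF.surjOn hm
      exact ⟨w, fun _ => ⟨hw, hsm⟩⟩
    · exact ⟨p, fun h => absurd h hs⟩
  choose φ hφ using hφ
  refine ⟨φ, fun s hs t ht => ?_, fun z hz => ?_⟩
  · obtain ⟨hsN, hs'⟩ := hφ s hs
    obtain ⟨htN, ht'⟩ := hφ t ht
    have h₁ := abs_lt.1 (hFd _ hsN _ htN)
    have h₂ := dist_triangle4 s (F (φ s)) (F (φ t)) t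
    have h₃ := dist_triangle4 (F (φ s)) s t (F (φ t))
    rw [dist_comm (F (φ t)) t] at h₂
    rw [dist_comm (F (φ s)) s] at h₃
    exact abs_le.2 ⟨by linarith [h₁.1], by linarith [h₁.2]⟩
  · obtain ⟨hqN, hq⟩ := hφ q (mem_ball_self hR)
    have h₁ := abs_lt.1 (hFd _ hqN _ hp)
    rw [hFp, dist_comm (F (φ q)) q] at h₁
    have h₂ : l * dist z p ≤ l * dist z (φ q) + l * dist (φ q) p := by
      rw [← mul_add]
      exact mul_le_mul_of_nonneg_left (dist_triangle _ _ _) hl.le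
    obtain ⟨w, hw, hzw⟩ := hNd z (by linarith [h₁.2])
    have hFw := hMR (hF.mapsTo hw)
    obtain ⟨hN, hw'⟩ := hφ (F w) hFw
    have h₃ := abs_lt.1 (hFd _ hw _ hN)
    have h₄ : l * dist z (φ (F w)) ≤ l * dist z w + l * dist w (φ (F w)) := by
      rw [← mul_add]
      exact mul_le_mul_of_nonneg_left (dist_triangle _ _ _) hl.le
    exact ⟨F w, hFw, by linarith [h₃.2]⟩

/-- A weak tangent is approximated by a sequence of almost isometries from large balls of the
tangent to rescalings of the space. -/
lemma PointedWeakTangent.exists_almost_isometries (h : PointedWeakTangent Z S q) :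
    ∃ (l : ℕ → ℝ) (φ : ℕ → S → Z), (∀ j, 0 < l j) ∧ Tendsto l atTop atTop ∧
      ∀ j : ℕ, (∀ s ∈ ball q ((j : ℝ) + 1), ∀ t ∈ ball q ((j : ℝ) + 1),
          |l j * dist (φ j s) (φ j t) - dist s t| ≤ 3 * (1 / ((j : ℝ) + 1))) ∧
        ∀ z, l j * dist z (φ j q) < (j : ℝ) + 1 - 2 * (1 / ((j : ℝ) + 1)) →
          ∃ s ∈ ball q ((j : ℝ) + 1), l j * dist z (φ j s) ≤ 3 * (1 / ((j : ℝ) + 1)) := by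
  obtain ⟨-, l, p, hl, hlt, h⟩ := h
  have key : ∀ j : ℕ, ∃ k ≥ j, ∃ φ : S → Z, (∀ s ∈ ball q ((j : ℝ) + 1), ∀ t ∈ ball q ((j : ℝ) + 1),
          |l k * dist (φ s) (φ t) - dist s t| ≤ 3 * (1 / ((j : ℝ) + 1))) ∧
        ∀ z, l k * dist z (φ q) < (j : ℝ) + 1 - 2 * (1 / ((j : ℝ) + 1)) →
          ∃ s ∈ ball q ((j : ℝ) + 1), l k * dist z (φ s) ≤ 3 * (1 / ((j : ℝ) + 1)) := fun j => by
    obtain ⟨N, M, -, hMR, hMd, hN⟩ := h ((j : ℝ) + 1) (by positivity) (1 / ((j : ℝ) + 1))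
      (by positivity)
    obtain ⟨Mk, F, hp, -, hd, hFp, hF, hFd⟩ := hN (max N j) (le_max_left _ _)
    exact ⟨max N j, le_max_right _ _,
      exists_approximate_inverse (by positivity) (hl _) hMR hMd hp hd hFp hF hFd⟩
  choose k hk φ hφ using key
  exact ⟨fun j => l (k j), φ, fun j => hl _, hlt.comp (tendsto_atTop_mono hk tendsto_id), hφ⟩

lemma PointedWeakTangent.properSpace [CompactSpace Z] (h : PointedWeakTangent Z S q) :
    ProperSpace S := by
  have := h.1
  obtain ⟨l, φ, hl, -, hφ⟩ := h.exists_almost_isometries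
  have hcpt : ∀ r, IsCompact (closedBall q r) := fun r => by
    refine isCompact_iff_totallyBounded_isComplete.2 ⟨?_, isClosed_closedBall.isComplete⟩
    refine totallyBounded_of_finite_discretization fun ε hε => ?_
    obtain ⟨j, hj⟩ := exists_nat_gt (max r (6 / ε))
    have hjr : r < j + 1 := by linarith [le_max_left r (6 / ε)]
    have hjε : 3 * (1 / ((j : ℝ) + 1)) < ε / 2 := by
      have h₁ : 6 / ε < j + 1 := by linarith [le_max_right r (6 / ε)]
      rw [div_lt_iff₀ hε] at h₁
      rw [mul_one_div, div_lt_iff₀ (by positivity)]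
      linarith
    obtain ⟨T, hT, hcov⟩ := Metric.totallyBounded_iff.1
      (isCompact_univ (X := Z)).totallyBounded (ε / 4 / l j) (div_pos (by positivity) (hl j))
    have hnear : ∀ s : closedBall q r, ∃ c : T, dist (φ j s) c < ε / 4 / l j := fun s => by
      obtain ⟨c, hc, hd⟩ := mem_iUnion₂.1 (hcov (mem_univ (φ j s)))
      exact ⟨⟨c, hc⟩, hd⟩
    choose c hc using hnear
    have := hT.fintype
    refine ⟨ULift (Fin (Fintype.card T)), inferInstance, fun s => ⟨Fintype.equivFin T (c s)⟩,
      fun s t hst => ?_⟩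
    replace hst : c s = c t := (Fintype.equivFin T).injective (congrArg ULift.down hst)
    have hs : (s : S) ∈ ball q ((j : ℝ) + 1) := closedBall_subset_ball hjr s.2
    have ht : (t : S) ∈ ball q ((j : ℝ) + 1) := closedBall_subset_ball hjr t.2
    have h₁ := (abs_le.1 ((hφ j).1 _ hs _ ht)).1
    have h₂ : l j * dist (φ j s) (φ j t) < ε / 2 := by
      have h₃ := hc s
      have h₄ := hc t
      rw [← hst, dist_comm] at h₄
      rw [lt_div_iff₀ (hl j)] at h₃ h₄
      have := mul_le_mul_of_nonneg_left (dist_triangle (φ j s) (c s : Z) (φ j t)) (hl j).le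
      linarith
    linarith
  refine ProperSpace.of_isCompact_closedBall_of_le 0 fun x r hr => ?_
  refine (hcpt (r + dist x q)).of_isClosed_subset isClosed_closedBall ?_
  exact closedBall_subset_closedBall' le_rfl

/-- Approximating maps of a weak tangent, with the surjectivity expressed along ultrafilters. -/
lemma PointedWeakTangent.exists_approximation [CompactSpace Z] (h : PointedWeakTangent Z S q)
    (L : Ultrafilter ℕ) (hL : (L : Filter ℕ) ≤ atTop) :
    ∃ (l : ℕ → ℝ) (φ : ℕ → S → Z), (∀ j, 0 < l j) ∧ Tendsto l L atTop ∧
      (∀ s t, Tendsto (fun j => l j * dist (φ j s) (φ j t)) L (𝓝 (dist s t))) ∧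
      ∀ (z : ℕ → Z) (C : ℝ), (∀ᶠ j in (L : Filter ℕ), l j * dist (z j) (φ j q) ≤ C) →
        ∃ s, Tendsto (fun j => l j * dist (z j) (φ j s)) L (𝓝 0) := by
  have := h.properSpace
  obtain ⟨l, φ, hl, hlt, hφ⟩ := h.exists_almost_isometries
  have h0 : Tendsto (fun j : ℕ => 3 * (1 / ((j : ℝ) + 1))) L (𝓝 0) := by
    simpa using (tendsto_one_div_add_atTop_nhds_zero_nat.const_mul (3 : ℝ)).mono_left hL
  have hlarge : ∀ r : ℝ, ∀ᶠ j : ℕ in (L : Filter ℕ), r < (j : ℝ) := fun r =>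
    hL (tendsto_natCast_atTop_atTop.eventually_gt_atTop r)
  refine ⟨l, φ, hl, hlt.mono_left hL, fun s t => ?_, fun z C hz => ?_⟩
  · rw [tendsto_iff_dist_tendsto_zero]
    refine squeeze_zero' (Eventually.of_forall fun _ => dist_nonneg) ?_ h0
    filter_upwards [hlarge (dist s q), hlarge (dist t q)] with j hs ht
    exact (hφ j).1 s (mem_ball.2 (by linarith)) t (mem_ball.2 (by linarith))
  · have hex : ∀ j, ∃ s : S, l j * dist (z j) (φ j q) < (j : ℝ) + 1 - 2 * (1 / ((j : ℝ) + 1)) →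
        s ∈ ball q ((j : ℝ) + 1) ∧ l j * dist (z j) (φ j s) ≤ 3 * (1 / ((j : ℝ) + 1)) :=
      fun j => by
        by_cases hj : l j * dist (z j) (φ j q) < (j : ℝ) + 1 - 2 * (1 / ((j : ℝ) + 1))
        · obtain ⟨s, hs⟩ := (hφ j).2 _ hj
          exact ⟨s, fun _ => hs⟩
        · exact ⟨q, fun h => absurd h hj⟩
    choose s hs using hex
    have hs' : ∀ᶠ j : ℕ in (L : Filter ℕ), s j ∈ ball q ((j : ℝ) + 1) ∧
        l j * dist (z j) (φ j (s j)) ≤ 3 * (1 / ((j : ℝ) + 1)) := by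
      filter_upwards [hz, hlarge (C + 2)] with j hj hj'
      refine hs j ?_
      have : 1 / ((j : ℝ) + 1) ≤ 1 := by
        rw [div_le_one (by positivity)]
        linarith [Nat.cast_nonneg (α := ℝ) j]
      linarith
    have hbdd : ∀ᶠ j in (L : Filter ℕ), s j ∈ closedBall q (C + 6) := by
      filter_upwards [hz, hs'] with j hj hsj
      have h₁ := (abs_le.1 ((hφ j).1 _ hsj.1 q (mem_ball_self (by positivity)))).1
      have h₂ := mul_le_mul_of_nonneg_left (dist_triangle (φ j (s j)) (z j) (φ j q)) (hl j).le
      rw [dist_comm (φ j (s j)) (z j)] at h₂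
      have : 1 / ((j : ℝ) + 1) ≤ 1 := by
        rw [div_le_one (by positivity)]
        linarith [Nat.cast_nonneg (α := ℝ) j]
      rw [mem_closedBall]
      linarith [hsj.2]
    obtain ⟨x, -, hx⟩ := (isCompact_closedBall q (C + 6)).ultrafilter_le_nhds (L.map s)
      (le_principal_iff.2 hbdd)
    have hx : Tendsto s L (𝓝 x) := hx
    refine ⟨x, squeeze_zero' (Eventually.of_forall fun j => mul_nonneg (hl j).le dist_nonneg) ?_
      (by simpa only [add_zero] using (h0.add h0).add (tendsto_iff_dist_tendsto_zero.1 hx))⟩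
    filter_upwards [hs', hlarge (dist x q)] with j hsj hxj
    have h₁ := (abs_le.1 ((hφ j).1 _ hsj.1 x (mem_ball.2 (by linarith)))).2
    have h₂ := mul_le_mul_of_nonneg_left (dist_triangle (z j) (φ j (s j)) (φ j x)) (hl j).le
    linarith [hsj.2]

lemma PointedWeakTangent.subsingleton [Subsingleton Z] (h : PointedWeakTangent Z S q) :
    Subsingleton S := by
  obtain ⟨l, φ, -, -, hφ⟩ := h.exists_approximation (hyperfilter ℕ) Nat.hyperfilter_le_atTop
  refine ⟨fun s t => ?_⟩
  have hst : ∀ j, l j * dist (φ j s) (φ j t) = 0 := fun j => by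
    rw [Subsingleton.elim (φ j s) (φ j t), dist_self, mul_zero]
  exact dist_eq_zero.1 (tendsto_nhds_unique (hφ.1 s t) (by simp [hst]))

end WeakTangent

section TangentEmbedding

variable {Z : Type*} [MetricSpace Z] {S : Type*} [MetricSpace S]
  {L : Filter ℕ} {l : ℕ → ℝ} {φ : ℕ → S → Z} {y : ℕ → Z} {e : ℝ}

/-- Almost isometries `φ j` of `S` into the rescalings of `Z` by factors `l j → ∞`, together
with points `y j` of `Z` whose distances to the images converge to a positive number `e`. -/
structure RescaledFrame (L : Filter ℕ) (l : ℕ → ℝ) (φ : ℕ → S → Z) (y : ℕ → Z) (e : ℝ) :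
    Prop where
  scale_pos : ∀ j, 0 < l j
  scale_tendsto : Tendsto l L atTop
  tendsto_dist : ∀ s t, Tendsto (fun j => l j * dist (φ j s) (φ j t)) L (𝓝 (dist s t))
  far_pos : 0 < e
  tendsto_far : ∀ s, Tendsto (fun j => dist (φ j s) (y j)) L (𝓝 e)

/-- The sequence `x` in `Z` represents the point `s` of the weak tangent. -/
def Represents (L : Filter ℕ) (l : ℕ → ℝ) (φ : ℕ → S → Z) (x : ℕ → Z) (s : S) : Prop :=
  Tendsto (fun j => l j * dist (x j) (φ j s)) L (𝓝 0)

omit [MetricSpace S] in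
lemma represents_self (s : S) : Represents L l φ (fun j => φ j s) s := by
  simp only [Represents, dist_self, mul_zero]
  exact tendsto_const_nhds

lemma tendsto_zero_of_scale_mul {f : ℕ → ℝ} {c : ℝ} (hl : Tendsto l L atTop)
    (hf : Tendsto (fun j => l j * f j) L (𝓝 c)) : Tendsto f L (𝓝 0) := by
  have h := hf.div_atTop hl
  refine h.congr' ?_
  filter_upwards [hl.eventually_gt_atTop 0] with j hj
  rw [mul_div_cancel_left₀ _ hj.ne']

lemma tendsto_dist_of_dist_tendsto_zero {x x' w w' : ℕ → Z} {c : ℝ} {k : ℕ → ℝ}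
    (hk : ∀ j, 0 ≤ k j) (hx : Tendsto (fun j => k j * dist (x j) (x' j)) L (𝓝 0))
    (hw : Tendsto (fun j => k j * dist (w j) (w' j)) L (𝓝 0))
    (h : Tendsto (fun j => k j * dist (x' j) (w' j)) L (𝓝 c)) :
    Tendsto (fun j => k j * dist (x j) (w j)) L (𝓝 c) := by
  refine tendsto_of_tendsto_of_dist h (squeeze_zero (fun _ => dist_nonneg) (fun j => ?_)
    (by simpa only [add_zero] using hx.add hw))
  rw [Real.dist_eq, ← mul_sub, abs_mul, abs_of_nonneg (hk j), ← mul_add]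
  refine mul_le_mul_of_nonneg_left ?_ (hk j)
  have h₁ := dist_triangle4 (x' j) (x j) (w j) (w' j)
  have h₂ := dist_triangle4 (x j) (x' j) (w' j) (w j)
  rw [dist_comm (x' j) (x j)] at h₁
  rw [dist_comm (w' j) (w j)] at h₂
  exact abs_le.2 ⟨by linarith, by linarith⟩

namespace RescaledFrame

variable (F : RescaledFrame L l φ y e) {x x₁ x₂ x₃ : ℕ → Z} {s t u : S}
include F

lemma tendsto_dist_of_represents (h₁ : Represents L l φ x₁ s) (h₂ : Represents L l φ x₂ t) :
    Tendsto (fun j => l j * dist (x₁ j) (x₂ j)) L (𝓝 (dist s t)) :=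
  tendsto_dist_of_dist_tendsto_zero (fun j => (F.scale_pos j).le) h₁ h₂ (F.tendsto_dist s t)

lemma tendsto_far_of_represents (h : Represents L l φ x s) :
    Tendsto (fun j => dist (x j) (y j)) L (𝓝 e) := by
  have h₀ := tendsto_zero_of_scale_mul F.scale_tendsto h
  have := tendsto_dist_of_dist_tendsto_zero (k := fun _ => 1) (w := y) (w' := y) (x := x)
    (x' := fun j => φ j s) (fun _ => zero_le_one) (by simpa using h₀)
    (by simp only [dist_self, mul_zero]; exact tendsto_const_nhds)
    (by simpa using F.tendsto_far s)
  simpa using this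

lemma eventually_ne (h₁ : Represents L l φ x₁ s) (h₂ : Represents L l φ x₂ t) (hst : s ≠ t) :
    ∀ᶠ j in L, x₁ j ≠ x₂ j := by
  filter_upwards [(F.tendsto_dist_of_represents h₁ h₂).eventually_const_lt (dist_pos.2 hst)]
    with j hj heq
  rw [heq, dist_self, mul_zero] at hj
  exact lt_irrefl _ hj

lemma eventually_ne_far (h : Represents L l φ x s) : ∀ᶠ j in L, x j ≠ y j := by
  filter_upwards [(F.tendsto_far_of_represents h).eventually_const_lt F.far_pos] with j hj
  exact dist_pos.1 hj

variable [L.NeBot] {G : Type*} [Group G] [MulAction G Z] {η : NNReal ≃ₜ NNReal} {g : ℕ → G}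
  {w₁ w₂ w₃ w₄ : Z}

lemma limit_dist_mul_dist_le (hqm : ∀ g : G, IsQuasiMobius η (fun z : Z => g • z))
    (h₁ : Represents L l φ x₁ s) (h₂ : Represents L l φ x₂ u) (h₃ : Represents L l φ x₃ t)
    (hsu : s ≠ u) (hut : u ≠ t)
    (hw₁ : Tendsto (fun j => g j • x₁ j) L (𝓝 w₁)) (hw₂ : Tendsto (fun j => g j • x₂ j) L (𝓝 w₂))
    (hw₃ : Tendsto (fun j => g j • x₃ j) L (𝓝 w₃)) (hw₄ : Tendsto (fun j => g j • y j) L (𝓝 w₄)) :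
    dist w₁ w₃ * dist w₂ w₄ ≤
      realDistortion η (dist s t / dist u t) * (dist w₁ w₄ * dist w₂ w₃) := by
  have hcr : Tendsto (fun j => dist (x₁ j) (x₃ j) * dist (x₂ j) (y j) /
      (dist (x₁ j) (y j) * dist (x₂ j) (x₃ j))) L (𝓝 (dist s t / dist u t)) := by
    have hlim := ((F.tendsto_dist_of_represents h₁ h₃).mul (F.tendsto_far_of_represents h₂)).div
      ((F.tendsto_far_of_represents h₁).mul (F.tendsto_dist_of_represents h₂ h₃))
      (mul_ne_zero F.far_pos.ne' (dist_ne_zero.2 hut))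
    have heq : dist s t * e / (e * dist u t) = dist s t / dist u t := by
      rw [mul_comm, mul_div_mul_left _ _ F.far_pos.ne']
    rw [heq] at hlim
    refine hlim.congr fun j => ?_
    simp only [Pi.div_apply]
    rw [mul_assoc, mul_left_comm (dist (x₁ j) (y j)), mul_div_mul_left _ _ (F.scale_pos j).ne']
  refine le_of_tendsto_of_tendsto ((hw₁.dist hw₃).mul (hw₂.dist hw₄))
    ((((continuous_realDistortion η).tendsto _).comp hcr).mul
      ((hw₁.dist hw₄).mul (hw₂.dist hw₃))) ?_
  filter_upwards [F.eventually_ne h₁ h₂ hsu, F.eventually_ne_far h₁, F.eventually_ne h₂ h₃ hut,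
    F.eventually_ne_far h₃] with j h₁₂ h₁₄ h₂₃ h₃₄
  exact (hqm (g j)).dist_mul_dist_le h₁₂ h₁₄ h₂₃ h₃₄

lemma dist_le_of_limit (hqm : ∀ g : G, IsQuasiMobius η (fun z : Z => g • z))
    (h₁ : Represents L l φ x₁ s) (h₂ : Represents L l φ x₂ u) (h₃ : Represents L l φ x₃ t)
    (hsu : s ≠ u) (hut : u ≠ t)
    (hw₁ : Tendsto (fun j => g j • x₁ j) L (𝓝 w₁)) (hw₂ : Tendsto (fun j => g j • x₂ j) L (𝓝 w₂))
    (hw₃ : Tendsto (fun j => g j • x₃ j) L (𝓝 w₃)) (hw₄ : Tendsto (fun j => g j • y j) L (𝓝 w₄))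
    (hw₁₄ : w₁ ≠ w₄) (hw₂₃ : w₂ ≠ w₃) :
    dist s t ≤ realDistortion η (dist w₁ w₃ * dist w₂ w₄ / (dist w₁ w₄ * dist w₂ w₃)) *
      dist u t := by
  have hcr := ((hw₁.dist hw₃).mul (hw₂.dist hw₄)).div ((hw₁.dist hw₄).mul (hw₂.dist hw₃))
    (mul_ne_zero (dist_ne_zero.2 hw₁₄) (dist_ne_zero.2 hw₂₃))
  have hlim := le_of_tendsto_of_tendsto
    ((F.tendsto_dist_of_represents h₁ h₃).mul (F.tendsto_far_of_represents h₂))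
    ((((continuous_realDistortion η).tendsto _).comp hcr).mul
      ((F.tendsto_far_of_represents h₁).mul (F.tendsto_dist_of_represents h₂ h₃))) (by
    filter_upwards [F.eventually_ne h₁ h₂ hsu, F.eventually_ne_far h₁, F.eventually_ne h₂ h₃ hut,
      F.eventually_ne_far h₃] with j h₁₂ h₁₄ h₂₃ h₃₄
    have := mul_le_mul_of_nonneg_left
      (IsQuasiMobius.dist_mul_dist_le_of_smul hqm (g j) h₁₂ h₁₄ h₂₃ h₃₄) (F.scale_pos j).le
    simp only [Function.comp_apply, Pi.div_apply]
    linarith)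
  rw [mul_comm e, ← mul_assoc] at hlim
  exact le_of_mul_le_mul_right hlim F.far_pos

end RescaledFrame

/-- A weak tangent embeds as an open subset. -/
lemma PointedWeakTangent.exists_isOpenEmbedding [CompactSpace Z] [Nontrivial Z]
    (hup : UniformlyPerfect Z) {G : Type*} [Group G] [MulAction G Z] {η : NNReal ≃ₜ NNReal}
    (hqm : ∀ g : G, IsQuasiMobius η (fun z : Z => g • z)) (hcc : TriplesCocompact G Z) {q : S}
    (hS : PointedWeakTangent Z S q) : ∃ f : S → Z, IsOpenEmbedding f := by
  have := hS.properSpace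
  obtain ⟨δ, hδ, hcc⟩ := hcc
  set D := diam (univ : Set Z)
  have hDpos : 0 < D := diam_univ_pos
  set L := hyperfilter ℕ
  obtain ⟨l, φ, hl, hlt, hφ, hsurj⟩ := hS.exists_approximation L Nat.hyperfilter_le_atTop
  -- a far away sequence `y`
  obtain ⟨b₁, b₂, hb⟩ := exists_pair_ne Z
  have hy : ∀ j, ∃ y, dist b₁ b₂ / 2 ≤ dist (φ j q) y := fun j => by
    by_contra! hcon
    have := dist_triangle_left b₁ b₂ (φ j q)
    linarith [hcon b₁, hcon b₂]
  choose y hy using hy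
  obtain ⟨z₀, hz₀⟩ := exists_tendsto_of_ultrafilter L fun j => φ j q
  obtain ⟨y₀, hy₀⟩ := exists_tendsto_of_ultrafilter L y
  have hφz : ∀ s, Tendsto (fun j => φ j s) L (𝓝 z₀) := fun s =>
    tendsto_of_tendsto_of_dist hz₀ (tendsto_zero_of_scale_mul hlt (hφ q s))
  have hF : RescaledFrame L l φ y (dist z₀ y₀) :=
    ⟨hl, hlt, hφ, (half_pos (dist_pos.2 hb)).trans_le
      (ge_of_tendsto (hz₀.dist hy₀) (Eventually.of_forall hy)), fun s => (hφz s).dist hy₀⟩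
  -- a second point `a` of the tangent
  obtain ⟨a, hqa⟩ : ∃ a : S, q ≠ a := by
    obtain ⟨c, hc, hup⟩ := hup
    have hx : ∀ j, ∃ x, D⁻¹ ≤ l j → l j * dist x (φ j q) ≤ 1 ∧ c⁻¹ ≤ l j * dist x (φ j q) :=
      fun j => by
        by_cases hj : D⁻¹ ≤ l j
        · obtain ⟨x, hx, hx'⟩ := hup (φ j q) (l j)⁻¹ (inv_pos.2 (hl j))
            ((inv_le_comm₀ (hl j) hDpos).2 hj)
          refine ⟨x, fun _ => ⟨?_, ?_⟩⟩
          · rw [mem_closedBall, ← one_div, le_div_iff₀ (hl j)] at hx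
            linarith
          · rw [mem_ball, not_lt, div_eq_mul_inv, mul_comm, ← div_eq_mul_inv,
              div_le_iff₀ (hl j)] at hx'
            linarith
        · exact ⟨φ j q, fun h => absurd h hj⟩
    choose x hx using hx
    have hev := hlt.eventually_ge_atTop D⁻¹
    obtain ⟨a, ha⟩ := hsurj x 1 (hev.mono fun j hj => (hx j hj).1)
    refine ⟨a, fun hqa => ?_⟩
    rw [← hqa] at ha
    have := ge_of_tendsto ha (hev.mono fun j hj => (hx j hj).2)
    exact absurd (inv_pos.2 (zero_lt_one.trans_le hc)) (not_lt.2 this)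
  -- normalizing group elements
  have hg : ∀ j, ∃ g : G, φ j q ≠ φ j a ∧ φ j q ≠ y j ∧ φ j a ≠ y j →
      δ ≤ dist (g • φ j q) (g • φ j a) ∧ δ ≤ dist (g • φ j q) (g • y j) ∧
        δ ≤ dist (g • φ j a) (g • y j) := fun j => by
    by_cases h : φ j q ≠ φ j a ∧ φ j q ≠ y j ∧ φ j a ≠ y j
    · obtain ⟨g, hg⟩ := hcc _ _ _ h.1 h.2.1 h.2.2
      exact ⟨g, fun _ => hg⟩
    · exact ⟨1, fun h' => absurd h' h⟩
  choose g hg using hg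
  have hg' := ((hF.eventually_ne (represents_self q) (represents_self a) hqa).and
    ((hF.eventually_ne_far (represents_self q)).and
      (hF.eventually_ne_far (represents_self a)))).mono hg
  choose f hf using fun s => exists_tendsto_of_ultrafilter L fun j => g j • φ j s
  obtain ⟨w, hw⟩ := exists_tendsto_of_ultrafilter L fun j => g j • y j
  have hfqa : δ ≤ dist (f q) (f a) := ge_of_tendsto ((hf q).dist (hf a)) (hg'.mono fun _ h => h.1)
  have hfq : δ ≤ dist (f q) w := ge_of_tendsto ((hf q).dist hw) (hg'.mono fun _ h => h.2.1)
  have hfa : δ ≤ dist (f a) w := ge_of_tendsto ((hf a).dist hw) (hg'.mono fun _ h => h.2.2)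
  have hbase : ∀ s, ∃ u, s ≠ u ∧ δ ≤ dist (f u) w := fun s => by
    by_cases h : s = q
    · exact ⟨a, h ▸ hqa, hfa⟩
    · exact ⟨q, h, hfq⟩
  have hθ : ∀ {d r : ℝ} {w₁ w₂ w₃ w₄ : Z},
      d * δ ≤ realDistortion η r * (dist w₁ w₂ * dist w₃ w₄) →
      d ≤ realDistortion η r * (D * D) / δ := fun {d r w₁ w₂ w₃ w₄} h => by
    rw [le_div_iff₀ hδ]
    refine h.trans (mul_le_mul_of_nonneg_left ?_ (realDistortion_nonneg η r))
    gcongr <;> exact dist_le_diam_univ _ _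
  have hθ0 : Tendsto (fun r => realDistortion η r * (D * D) / δ) (𝓝 0) (𝓝 0) := by
    have := (((continuous_realDistortion η).tendsto 0).mul_const (D * D)).div_const δ
    rwa [realDistortion_zero, zero_mul, zero_div] at this
  have hcontf : Continuous f := by
    refine continuous_iff_continuousAt.2 fun s => ?_
    obtain ⟨u, hsu, hu⟩ := hbase s
    have hr : Tendsto (fun t => dist s t / dist u t) (𝓝 s) (𝓝 0) := by
      have := (tendsto_const_nhds.dist tendsto_id : Tendsto (fun t => dist s t) (𝓝 s) _).div
        (tendsto_const_nhds.dist tendsto_id : Tendsto (fun t => dist u t) (𝓝 s) _)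
        (dist_ne_zero.2 hsu.symm)
      rw [dist_self, zero_div] at this
      exact this
    refine tendsto_iff_dist_tendsto_zero.2
      (squeeze_zero' (Eventually.of_forall fun _ => dist_nonneg) ?_ (hθ0.comp hr))
    filter_upwards [isOpen_ne.mem_nhds hsu] with t ht
    rw [dist_comm]
    refine hθ (le_trans (mul_le_mul_of_nonneg_left hu dist_nonneg)
      (hF.limit_dist_mul_dist_le hqm (represents_self s) (represents_self u) (represents_self t)
        hsu (Ne.symm ht) (hf s) (hf u) (hf t) hw))
  have hinfty : Tendsto f (cocompact S) (𝓝 w) := by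
    have hr : Tendsto (fun s => dist q a / dist s a) (cocompact S) (𝓝 0) :=
      tendsto_const_nhds.div_atTop (tendsto_dist_right_cocompact_atTop a)
    refine tendsto_iff_dist_tendsto_zero.2
      (squeeze_zero' (Eventually.of_forall fun _ => dist_nonneg) ?_ (hθ0.comp hr))
    filter_upwards [(isCompact_singleton (x := q)).compl_mem_cocompact,
      (isCompact_singleton (x := a)).compl_mem_cocompact] with s hsq hsa
    refine hθ (le_trans ?_ (hF.limit_dist_mul_dist_le hqm (represents_self q)
      (represents_self s) (represents_self a) (Ne.symm hsq) hsa (hf q) (hf s) (hf a) hw))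
    rw [mul_comm]
    exact mul_le_mul_of_nonneg_right hfqa dist_nonneg
  have hne : ∀ s, f s ≠ w := fun s hs => by
    by_cases hsq : s = q
    · rw [← hsq, hs, dist_self] at hfq
      exact absurd hδ (not_lt.2 hfq)
    by_cases hsa : s = a
    · rw [← hsa, hs, dist_self] at hfa
      exact absurd hδ (not_lt.2 hfa)
    have hle := hF.dist_le_of_limit hqm (represents_self q) (represents_self s)
      (represents_self a) (Ne.symm hsq) hsa (hf q) (hf s) (hf a) hw
      (dist_pos.1 (hδ.trans_le hfq)) (hs ▸ (dist_pos.1 (hδ.trans_le hfa)).symm)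
    rw [hs, dist_self, mul_zero, zero_div, realDistortion_zero, zero_mul] at hle
    exact absurd (dist_pos.2 hqa) (not_lt.2 hle)
  have hinj : Function.Injective f := fun s t hst => by
    obtain ⟨u, hu⟩ : ∃ u, f u ≠ f t := by
      by_contra! hcon
      rw [hcon q, hcon a, dist_self] at hfqa
      exact absurd hδ (not_lt.2 hfqa)
    have hle := hF.dist_le_of_limit hqm (represents_self s) (represents_self u)
      (represents_self t) (fun h => hu (h ▸ hst)) (fun h => hu (h ▸ rfl)) (hf s) (hf u) (hf t) hw
      (hne s) hu
    rw [hst, dist_self, zero_mul, zero_div, realDistortion_zero, zero_mul] at hle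
    exact dist_le_zero.1 hle
  have hrange : ∀ v, v ≠ w → v ∈ range f := fun v hv => by
    by_cases hva : v = f a
    · exact ⟨a, hva.symm⟩
    set z : ℕ → Z := fun j => (g j)⁻¹ • v
    have hgz : ∀ j, g j • z j = v := fun j => smul_inv_smul _ _
    have hcr : Tendsto (fun j => dist v (g j • φ j q) * dist (g j • φ j a) (g j • y j) /
        (dist v (g j • y j) * dist (g j • φ j a) (g j • φ j q))) L
        (𝓝 (dist v (f q) * dist (f a) w / (dist v w * dist (f a) (f q)))) :=
      ((tendsto_const_nhds.dist (hf q)).mul ((hf a).dist hw)).div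
        ((tendsto_const_nhds.dist hw).mul ((hf a).dist (hf q)))
        (mul_ne_zero (dist_ne_zero.2 hv)
          (by rw [dist_comm]; exact (hδ.trans_le hfqa).ne'))
    have hbd := ((((continuous_realDistortion η).tendsto _).comp hcr).mul
      ((hφ a q).const_mul D)).div (hF.tendsto_far a) hF.far_pos.ne'
    obtain ⟨C, hC⟩ : ∃ C, ∀ᶠ j in (L : Filter ℕ), l j * dist (z j) (φ j q) ≤ C := by
      refine ⟨realDistortion η (dist v (f q) * dist (f a) w / (dist v w * dist (f a) (f q))) *
        (D * dist a q) / dist z₀ y₀ + 1, ?_⟩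
      filter_upwards [hbd.eventually_le_const (lt_add_one _),
        (hf a).eventually_ne (Ne.symm hva), hw.eventually_ne (Ne.symm hv),
        hF.eventually_ne (represents_self a) (represents_self q) hqa.symm,
        hF.eventually_ne_far (represents_self q), hF.eventually_ne_far (represents_self a)]
        with j hj hja hjw haq hqy hay
      refine le_trans ?_ hj
      have hza : z j ≠ φ j a := fun h => hja (by rw [← h, hgz])
      have hzy : z j ≠ y j := fun h => hjw (by rw [← h, hgz])
      have hmain := IsQuasiMobius.dist_mul_dist_le_of_smul hqm (g j) hza hzy haq hqy
      rw [hgz] at hmain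
      simp only [Pi.div_apply, Function.comp_apply]
      rw [le_div_iff₀ (dist_pos.2 hay), mul_assoc]
      refine (mul_le_mul_of_nonneg_left hmain (hl j).le).trans ?_
      rw [mul_left_comm]
      refine mul_le_mul_of_nonneg_left ?_ (realDistortion_nonneg η _)
      rw [mul_left_comm]
      exact mul_le_mul_of_nonneg_right (dist_le_diam_univ _ _)
        (mul_nonneg (hl j).le dist_nonneg)
    obtain ⟨s, hs⟩ := hsurj z C hC
    obtain ⟨u, hsu, hu⟩ := hbase s
    have hle := hF.limit_dist_mul_dist_le hqm hs (represents_self u) (represents_self s) hsu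
      hsu.symm (w₁ := v) (by simp only [hgz]; exact tendsto_const_nhds) (hf u) (hf s) hw
    rw [dist_self, zero_div, realDistortion_zero, zero_mul] at hle
    have := nonpos_of_mul_nonpos_left hle (hδ.trans_le hu)
    exact ⟨s, (dist_le_zero.1 this).symm⟩
  -- extend to the one-point compactification
  let f' : OnePoint S → Z := fun x => x.elim w f
  have hf'c : Continuous f' := (OnePoint.continuous_iff f').2
    ⟨by rw [coclosedCompact_eq_cocompact]; exact hinfty, hcontf⟩
  have hf'i : Function.Injective f' := by
    intro x x'
    induction x using OnePoint.rec <;> induction x' using OnePoint.rec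
    · simp
    · exact fun h => absurd h.symm (hne _)
    · exact fun h => absurd h (hne _)
    · exact fun h => congrArg _ (hinj h)
  have hf's : Function.Surjective f' := fun v => by
    by_cases hv : v = w
    · exact ⟨OnePoint.infty, hv.symm⟩
    · obtain ⟨s, hs⟩ := hrange v hv
      exact ⟨s, hs⟩
  have hf'o : IsOpenEmbedding f' :=
    ⟨(hf'c.isClosedEmbedding hf'i).isEmbedding, by rw [hf's.range_eq]; exact isOpen_univ⟩
  exact ⟨f, hf'o.comp OnePoint.isOpenEmbedding_coe⟩

end TangentEmbedding

universe u

/-- **Bonk–Kleiner, Lemma 5.3.** If `Z` is compact, uniformly perfect and doubling,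
`G ↷ Z` is uniformly quasi-Möbius with cocompact induced action on distinct triples,
and `Z` has topological dimension `n`, then every nonempty open subset of `Z` and
every nonempty open subset of any weak tangent of `Z` has topological dimension `n`. -/
theorem open_subsets_have_full_dimension {Z : Type*} [MetricSpace Z] [CompactSpace Z]
    (hup : UniformlyPerfect Z) (hdb : MetricDoubling Z)
    {G : Type*} [Group G] [MulAction G Z] (η : NNReal ≃ₜ NNReal)
    (hcont : ∀ g : G, Continuous fun z : Z => g • z)
    (hqm : ∀ g : G, IsQuasiMobius η (fun z : Z => g • z))
    (hcc : TriplesCocompact G Z)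
    (n : ℕ) (hdim : topDim Z = (n : ℕ∞)) :
    (∀ U : Set Z, IsOpen U → U.Nonempty → topDim ↥U = (n : ℕ∞)) ∧
    ∀ (S : Type u) [MetricSpace S] (q : S), PointedWeakTangent Z S q →
      ∀ V : Set S, IsOpen V → V.Nonempty → topDim ↥V = (n : ℕ∞) := by
  have hopen : ∀ U : Set Z, IsOpen U → U.Nonempty → topDim ↥U = (n : ℕ∞) := fun U hU hne => by
    rw [← hdim]
    refine topDim_congr fun m => ?_
    rcases subsingleton_or_nontrivial Z with hZ | hZ
    · exact iff_of_true (covDimLE_of_subsingleton m) (covDimLE_of_subsingleton m)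
    · exact ⟨covDimLE_of_isOpen_subset hup hcont hqm hcc hU hne, fun h => h.of_isOpen hU⟩
  refine ⟨hopen, fun S _ q hS V hV hne => ?_⟩
  rcases subsingleton_or_nontrivial Z with hZ | hZ
  · have := hS.subsingleton
    rw [← hdim]
    exact topDim_congr fun m =>
      iff_of_true (covDimLE_of_subsingleton m) (covDimLE_of_subsingleton m)
  · obtain ⟨f, hf⟩ := hS.exists_isOpenEmbedding hup hqm hcc
    rw [← hopen (f '' V) (hf.isOpenMap V hV) (hne.image f)]
    let e := hf.isEmbedding.homeomorphImage V
    exact topDim_congr fun m => ⟨fun h => h.of_isClosedEmbedding e.symm.isClosedEmbedding,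
      fun h => h.of_isClosedEmbedding e.isClosedEmbedding⟩
end
end

section
/- Suppose X and Y are compact metric spaces that are uniformly perfect and doubling, and suppose G ↷ X and H ↷ Y are uniformly quasi-Möbius actions by homeomorphisms for which the induced actions G ↷ Tri(X) and H ↷ Tri(Y) are cocompact. If there exist weak tangents S ∈ WT(X) and T ∈ WT(Y) and a quasi-symmetric homeomorphism f : S → T, then there exists a quasi-Möbius homeomorphism g : X → Y. -/
open Metric Set MeasureTheory Filter Topology

noncomputable section

theorem Homeomorph.strictMono_nnreal (η : NNReal ≃ₜ NNReal) : StrictMono η := by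
  rcases η.continuous.strictMono_of_inj η.injective with h | h
  · exact h
  · obtain ⟨x, hx⟩ := η.surjective (η 0 + 1)
    have h₁ : η x ≤ η 0 := h.antitone zero_le
    rw [hx] at h₁
    exact absurd h₁ (not_le.2 (lt_add_one _))

theorem Homeomorph.nnreal_map_zero (η : NNReal ≃ₜ NNReal) : η 0 = 0 := by
  obtain ⟨x, hx⟩ := η.surjective 0
  have h : η 0 ≤ η x := η.strictMono_nnreal.monotone zero_le
  rw [hx] at h
  exact le_antisymm h zero_le

section CrossRatio

variable {X Y : Type*} [MetricSpace X] [MetricSpace Y]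

theorem coe_crossRatio (a b c d : X) :
    (crossRatio a b c d : ℝ) = dist a c * dist b d / (dist a d * dist b c) := by
  simp [crossRatio]

/-- Cross-ratios are invariant under rescaling the metric, so they converge as soon as the
rescaled distances do. -/
theorem tendsto_crossRatio_of_scaled {ι : Type*} {L : Filter ι} {lam : ι → ℝ}
    (hlam : ∀ k, 0 < lam k) {a b c d : ι → X} {A B C D : ℝ}
    (hac : Tendsto (fun k => lam k * dist (a k) (c k)) L (𝓝 A))
    (hbd : Tendsto (fun k => lam k * dist (b k) (d k)) L (𝓝 B))
    (had : Tendsto (fun k => lam k * dist (a k) (d k)) L (𝓝 C))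
    (hbc : Tendsto (fun k => lam k * dist (b k) (c k)) L (𝓝 D)) (hC : C ≠ 0) (hD : D ≠ 0) :
    Tendsto (fun k => (crossRatio (a k) (b k) (c k) (d k) : ℝ)) L (𝓝 (A * B / (C * D))) := by
  refine ((hac.mul hbd).div (had.mul hbc) (mul_ne_zero hC hD)).congr fun k => ?_
  rw [coe_crossRatio, Pi.div_apply, mul_mul_mul_comm, mul_mul_mul_comm (lam k) (dist (a k) (d k)),
    mul_div_mul_left _ _ (mul_pos (hlam k) (hlam k)).ne']

theorem Filter.Tendsto.crossRatio {ι : Type*} {L : Filter ι} {a b c d : ι → X} {A B C D : X}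
    (ha : Tendsto a L (𝓝 A)) (hb : Tendsto b L (𝓝 B)) (hc : Tendsto c L (𝓝 C))
    (hd : Tendsto d L (𝓝 D)) (hAD : A ≠ D) (hBC : B ≠ C) :
    Tendsto (fun k => crossRatio (a k) (b k) (c k) (d k)) L (𝓝 (crossRatio A B C D)) :=
  ((ha.nndist hc).mul (hb.nndist hd)).div ((ha.nndist hd).mul (hb.nndist hc))
    (mul_ne_zero (by simpa using hAD) (by simpa using hBC))

theorem IsQuasiMobius.mul_le {η : NNReal ≃ₜ NNReal} {φ : X → Y} (hφ : IsQuasiMobius η φ)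
    {a b c d : X} (hab : a ≠ b) (had : a ≠ d) (hbc : b ≠ c) (hcd : c ≠ d) :
    dist (φ a) (φ c) * dist (φ b) (φ d) ≤
      η (crossRatio a b c d) * (dist (φ a) (φ d) * dist (φ b) (φ c)) := by
  by_cases hac : a = c
  · simp only [hac, dist_self, zero_mul]; positivity
  by_cases hbd : b = d
  · simp only [hbd, dist_self, mul_zero]; positivity
  have h : (crossRatio (φ a) (φ b) (φ c) (φ d) : ℝ) ≤ η (crossRatio a b c d) :=
    NNReal.coe_le_coe.2 (hφ.2 a b c d hab hac had hbc hbd hcd)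
  rwa [coe_crossRatio, div_le_iff₀ (mul_pos (dist_pos.2 (hφ.1.ne had))
    (dist_pos.2 (hφ.1.ne hbc)))] at h

/-- The quasi-Möbius inequality passes to limits of images. -/
theorem IsQuasiMobius.mul_le_of_tendsto {ι : Type*} {L : Filter ι} [L.NeBot]
    {η : NNReal ≃ₜ NNReal} {φ : ι → X → Y} (hφ : ∀ k, IsQuasiMobius η (φ k))
    {a b c d : ι → X} {A B C D : Y} {t : NNReal}
    (hab : ∀ᶠ k in L, a k ≠ b k) (had : ∀ᶠ k in L, a k ≠ d k) (hbc : ∀ᶠ k in L, b k ≠ c k)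
    (hcd : ∀ᶠ k in L, c k ≠ d k)
    (ht : Tendsto (fun k => (crossRatio (a k) (b k) (c k) (d k) : ℝ)) L (𝓝 t))
    (hA : Tendsto (fun k => φ k (a k)) L (𝓝 A)) (hB : Tendsto (fun k => φ k (b k)) L (𝓝 B))
    (hC : Tendsto (fun k => φ k (c k)) L (𝓝 C)) (hD : Tendsto (fun k => φ k (d k)) L (𝓝 D)) :
    dist A C * dist B D ≤ η t * (dist A D * dist B C) := by
  have hη : Tendsto (fun k => (η (crossRatio (a k) (b k) (c k) (d k)) : ℝ)) L (𝓝 (η t)) :=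
    NNReal.tendsto_coe.2 ((η.continuous.tendsto t).comp (NNReal.tendsto_coe.1 ht))
  refine le_of_tendsto_of_tendsto ((hA.dist hC).mul (hB.dist hD))
    (hη.mul ((hA.dist hD).mul (hB.dist hC))) ?_
  filter_upwards [hab, had, hbc, hcd] with k h₁ h₂ h₃ h₄
  exact (hφ k).mul_le h₁ h₂ h₃ h₄

theorem IsQuasiMobius.comp {Z : Type*} [MetricSpace Z] {η₁ η₂ : NNReal ≃ₜ NNReal} {φ : X → Y}
    {ψ : Y → Z} (hψ : IsQuasiMobius η₂ ψ) (hφ : IsQuasiMobius η₁ φ) :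
    IsQuasiMobius (η₁.trans η₂) (ψ ∘ φ) :=
  ⟨hψ.1.comp hφ.1, fun a b c d h₁ h₂ h₃ h₄ h₅ h₆ =>
    (hψ.2 _ _ _ _ (hφ.1.ne h₁) (hφ.1.ne h₂) (hφ.1.ne h₃) (hφ.1.ne h₄) (hφ.1.ne h₅)
      (hφ.1.ne h₆)).trans (η₂.strictMono_nnreal.monotone (hφ.2 a b c d h₁ h₂ h₃ h₄ h₅ h₆))⟩

/-- Quasi-Möbius maps of spaces with enough points are continuous. -/
theorem IsQuasiMobius.continuous {η : NNReal ≃ₜ NNReal} {φ : X → Y} (hφ : IsQuasiMobius η φ)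
    (hX : ∀ x : X, ∃ u v : X, u ≠ v ∧ x ≠ u ∧ x ≠ v) : Continuous φ := by
  refine continuous_iff_continuousAt.2 fun x => ?_
  obtain ⟨u, v, huv, hxu, hxv⟩ := hX x
  have hcr : Tendsto (fun z => (η (crossRatio z u x v) : ℝ)) (𝓝 x) (𝓝 0) := by
    have h := (tendsto_id (x := 𝓝 x)).crossRatio tendsto_const_nhds tendsto_const_nhds
      tendsto_const_nhds hxv hxu.symm
    have h₀ : crossRatio x u x v = 0 := by simp [crossRatio]
    rw [h₀] at h
    have h₁ := (η.continuous.tendsto 0).comp h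
    rw [η.nnreal_map_zero] at h₁
    exact NNReal.tendsto_coe.2 h₁
  set P := dist (φ u) (φ v) with hP
  set Q := dist (φ u) (φ x)
  set W := dist (φ x) (φ v)
  have hPpos : 0 < P := dist_pos.2 (hφ.1.ne huv)
  have hlim : Tendsto (fun z => 2 / P * ((η (crossRatio z u x v) : ℝ) * (W * Q))) (𝓝 x)
      (𝓝 0) := by
    simpa using (hcr.mul_const (W * Q)).const_mul (2 / P)
  have hsmall : ∀ᶠ z in 𝓝 x, (η (crossRatio z u x v) : ℝ) * Q < P / 2 := by
    have h : Tendsto (fun z => (η (crossRatio z u x v) : ℝ) * Q) (𝓝 x) (𝓝 0) := by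
      simpa using hcr.mul_const Q
    exact h.eventually_lt_const (by positivity)
  refine tendsto_iff_dist_tendsto_zero.2 (squeeze_zero' (Eventually.of_forall fun _ =>
    dist_nonneg) ?_ hlim)
  filter_upwards [hsmall, eventually_ne_nhds hxu, eventually_ne_nhds hxv] with z hz hzu hzv
  have h := hφ.mul_le (c := x) hzu hzv hxu.symm hxv
  set e : ℝ := (η (crossRatio z u x v) : ℝ)
  have he : 0 ≤ e := NNReal.coe_nonneg _
  have htri : dist (φ z) (φ v) ≤ dist (φ z) (φ x) + W := dist_triangle _ _ _
  have hQ : 0 ≤ Q := dist_nonneg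
  have hd : 0 ≤ dist (φ z) (φ x) := dist_nonneg
  have h₁ : dist (φ z) (φ x) * P ≤ e * Q * dist (φ z) (φ x) + e * (W * Q) := by
    calc _ ≤ e * (dist (φ z) (φ v) * Q) := h
      _ ≤ e * ((dist (φ z) (φ x) + W) * Q) := by gcongr
      _ = _ := by ring
  have h₂ : e * Q * dist (φ z) (φ x) ≤ P / 2 * dist (φ z) (φ x) := by gcongr
  rw [div_mul_eq_mul_div, le_div_iff₀ hPpos]
  linarith

end CrossRatio

section WeakTangent

variable {X S : Type*} [MetricSpace X] [MetricSpace S]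

/-- `S` is the limit of the rescaled spaces `lam k • X` along the ultrafilter `U`; the point
`s : S` is represented by the sequence `σ k s`, and every sequence that stays at bounded rescaled
distance from the base points represents a point of `S`. -/
structure IsRescaledLimit (U : Ultrafilter ℕ) (lam : ℕ → ℝ) (σ : ℕ → S → X) (q : S) : Prop where
  pos : ∀ k, 0 < lam k
  tendsto_atTop : Tendsto lam U atTop
  tendsto_dist : ∀ s t, Tendsto (fun k => lam k * dist (σ k s) (σ k t)) U (𝓝 (dist s t))
  exists_limit : ∀ (x : ℕ → X) (R : ℝ), (∀ᶠ k in (U : Filter ℕ), lam k * dist (x k) (σ k q) ≤ R) →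
    ∃ s, Tendsto (fun k => lam k * dist (x k) (σ k s)) U (𝓝 0)

/-- The inner approximation data in the definition of a weak tangent give maps in both
directions between large balls. -/
theorem exists_approx_maps {l R ε : ℝ} (hl : 0 < l) (hR : 0 < R) {q : S} {p : X} {M : Set S}
    {Mk : Set X} {F : X → S} (hMd : ∀ s ∈ ball q R, ∃ m ∈ M, dist s m ≤ ε) (hp : p ∈ Mk)
    (hMkd : ∀ z : X, l * dist z p < R → ∃ w ∈ Mk, l * dist z w ≤ ε) (hF : F p = q)
    (hbij : BijOn F Mk M) (hdist : ∀ a ∈ Mk, ∀ b ∈ Mk, |l * dist a b - dist (F a) (F b)| < ε) :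
    ∃ τρ : (X → S) × (S → X),
      (∀ s ∈ ball q R, ∀ t ∈ ball q R,
        |l * dist (τρ.2 s) (τρ.2 t) - dist s t| ≤ 3 * ε) ∧
      (∀ x, l * dist x p < R → ∀ s ∈ ball q R,
        l * dist x (τρ.2 s) ≤ dist (τρ.1 x) s + 3 * ε) ∧
      (∀ x, l * dist x p < R → dist (τρ.1 x) q ≤ l * dist x p + 2 * ε) ∧
      l * dist (τρ.2 q) p ≤ 2 * ε := by
  have hw : ∀ x, ∃ w, l * dist x p < R → w ∈ Mk ∧ l * dist x w ≤ ε := fun x => by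
    by_cases h : l * dist x p < R
    · obtain ⟨w, hw⟩ := hMkd x h
      exact ⟨w, fun _ => hw⟩
    · exact ⟨x, fun h' => absurd h' h⟩
  choose w hw using hw
  have hρ : ∀ s, ∃ z, s ∈ ball q R → z ∈ Mk ∧ dist s (F z) ≤ ε := fun s => by
    by_cases h : s ∈ ball q R
    · obtain ⟨m, hm, hsm⟩ := hMd s h
      obtain ⟨z, hz, rfl⟩ := hbij.surjOn hm
      exact ⟨z, fun _ => ⟨hz, hsm⟩⟩
    · exact ⟨p, fun h' => absurd h' h⟩
  choose ρ hρ using hρ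
  refine ⟨(fun x => F (w x), ρ), fun s hs t ht => ?_, fun x hx s hs => ?_, fun x hx => ?_, ?_⟩
  · obtain ⟨h₁, h₂⟩ := hρ s hs
    obtain ⟨h₃, h₄⟩ := hρ t ht
    have h₅ := abs_lt.1 (hdist _ h₁ _ h₃)
    have h₆ := dist_triangle4 s (F (ρ s)) (F (ρ t)) t
    have h₇ := dist_triangle4 (F (ρ s)) s t (F (ρ t))
    rw [dist_comm (F (ρ t)) t] at h₆
    rw [dist_comm (F (ρ s)) s] at h₇
    exact abs_le.2 ⟨by linarith, by linarith⟩
  · obtain ⟨h₁, h₂⟩ := hρ s hs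
    obtain ⟨h₃, h₄⟩ := hw x hx
    have h₅ := abs_lt.1 (hdist _ h₃ _ h₁)
    have h₆ := mul_le_mul_of_nonneg_left (dist_triangle x (w x) (ρ s)) hl.le
    have h₇ := dist_triangle (F (w x)) s (F (ρ s))
    dsimp only
    linarith
  · obtain ⟨h₃, h₄⟩ := hw x hx
    have h₅ := abs_lt.1 (hdist _ h₃ _ hp)
    have h₆ := mul_le_mul_of_nonneg_left (dist_triangle (w x) x p) hl.le
    rw [dist_comm (w x) x] at h₆
    rw [hF] at h₅
    dsimp only
    linarith
  · obtain ⟨h₁, h₂⟩ := hρ q (mem_ball_self hR)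
    have h₅ := abs_lt.1 (hdist _ h₁ _ hp)
    rw [hF, dist_comm (F (ρ q))] at h₅
    dsimp only
    linarith

theorem PointedWeakTangent.isCompact_closedBall [CompactSpace X] {q : S}
    (h : PointedWeakTangent X S q) (R : ℝ) : IsCompact (closedBall q R) := by
  obtain ⟨hc, lam, p, hpos, -, happ⟩ := h
  refine (Metric.totallyBounded_iff.2 fun ε hε => ?_).isCompact_of_isClosed
    isClosed_closedBall
  obtain ⟨N, M, -, -, hMd, hN⟩ := happ (|R| + 1) (by positivity) (ε / 4) (by positivity)
  obtain ⟨Mk, F, -, -, -, -, hbij, hdist⟩ := hN N le_rfl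
  have hl := hpos N
  have hMk : TotallyBounded Mk := isCompact_univ.totallyBounded.subset (subset_univ _)
  obtain ⟨t, htM, htf, ht⟩ := Metric.finite_approx_of_totallyBounded hMk (ε / 4 / lam N)
    (by positivity)
  refine ⟨F '' t, htf.image F, fun s hs => ?_⟩
  have hs' : s ∈ ball q (|R| + 1) :=
    mem_ball.2 ((mem_closedBall.1 hs).trans_lt (by linarith [le_abs_self R]))
  obtain ⟨m, hm, hsm⟩ := hMd s hs'
  obtain ⟨z, hz, rfl⟩ := hbij.surjOn hm
  obtain ⟨c, hc, hzc⟩ := mem_iUnion₂.1 (ht hz)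
  refine mem_iUnion₂.2 ⟨F c, mem_image_of_mem F hc, mem_ball.2 ?_⟩
  rw [mem_ball, lt_div_iff₀ hl, mul_comm] at hzc
  have h₁ := abs_lt.1 (hdist z hz c (htM hc))
  have h₂ := dist_triangle s (F z) (F c)
  linarith

theorem exists_diagonal_sequence (N : ℕ → ℕ) :
    ∃ ν : ℕ → ℕ, Tendsto ν atTop atTop ∧ ∀ᶠ k in atTop, N (ν k) ≤ k := by
  classical
  refine ⟨fun k => Nat.findGreatest (fun n => N n ≤ k) k, tendsto_atTop.2 fun n => ?_, ?_⟩
  · filter_upwards [eventually_ge_atTop n, eventually_ge_atTop (N n)] with k h₁ h₂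
    exact Nat.le_findGreatest h₁ h₂
  · filter_upwards [eventually_ge_atTop (N 0)] with k hk
    exact Nat.findGreatest_spec (P := fun n => N n ≤ k) (Nat.zero_le k) hk

theorem PointedWeakTangent.exists_isRescaledLimit [CompactSpace X] {q : S}
    (h : PointedWeakTangent X S q) (U : Ultrafilter ℕ) (hU : (U : Filter ℕ) ≤ atTop) :
    ∃ (lam : ℕ → ℝ) (σ : ℕ → S → X), IsRescaledLimit U lam σ q := by
  have hcpt := h.isCompact_closedBall
  obtain ⟨-, lam, p, hpos, htop, happ⟩ := h
  have hε : ∀ n : ℕ, (0 : ℝ) < 1 / (n + 1) := fun n => by positivity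
  choose N M _ _ hMd hN using fun n : ℕ =>
    happ ((n : ℝ) + 1) (by positivity) (1 / ((n : ℝ) + 1)) (hε n)
  obtain ⟨ν, hν, hNν⟩ := exists_diagonal_sequence N
  have : Nonempty X := ⟨p 0⟩
  have : Nonempty S := ⟨q⟩
  have hmaps := hNν.mono fun k hk => by
    obtain ⟨Mk, F, hp, -, hMkd, hF, hbij, hdist⟩ := hN (ν k) k hk
    exact exists_approx_maps (hpos k) (by positivity) (hMd (ν k)) hp hMkd hF hbij
      hdist
  obtain ⟨τρ, hτρ⟩ := (hmaps.filter_mono hU).choice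
  have hRtop : Tendsto (fun k => (ν k : ℝ) + 1) U atTop :=
    tendsto_atTop_add_const_right _ _
      (tendsto_natCast_atTop_atTop.comp (hν.mono_left hU))
  have hε0 : Tendsto (fun k => 1 / ((ν k : ℝ) + 1)) U (𝓝 0) :=
    tendsto_const_nhds.div_atTop hRtop
  have hε3 : Tendsto (fun k => 3 * (1 / ((ν k : ℝ) + 1))) U (𝓝 0) := by
    simpa using hε0.const_mul 3
  have hball : ∀ s : S, ∀ᶠ k in (U : Filter ℕ), s ∈ ball q ((ν k : ℝ) + 1) := fun s =>
    (hRtop.eventually_gt_atTop (dist s q)).mono fun k hk => hk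
  refine ⟨lam, fun k => (τρ k).2, hpos, htop.mono_left hU, fun s t => ?_, fun x R hx => ?_⟩
  · refine tendsto_iff_dist_tendsto_zero.2 (squeeze_zero' (Eventually.of_forall fun _ =>
      dist_nonneg) ?_ hε3)
    filter_upwards [hτρ, hball s, hball t] with k hk hs ht
    exact hk.1 s hs t ht
  · have hxp : ∀ᶠ k in (U : Filter ℕ), lam k * dist (x k) (p k) ≤ R + 1 := by
      filter_upwards [hτρ, hx, hε0.eventually_lt_const (show (0 : ℝ) < 1 / 2 by norm_num)]
        with k hk hxk hek
      have h₁ := mul_le_mul_of_nonneg_left (dist_triangle (x k) ((τρ k).2 q) (p k)) (hpos k).le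
      linarith [hk.2.2.2]
    have hxR : ∀ᶠ k in (U : Filter ℕ), lam k * dist (x k) (p k) < (ν k : ℝ) + 1 := by
      filter_upwards [hxp, hRtop.eventually_gt_atTop (R + 1)] with k h₁ h₂
      exact h₁.trans_lt h₂
    have hmem : ∀ᶠ k in (U : Filter ℕ), (τρ k).1 (x k) ∈ closedBall q (R + 2) := by
      filter_upwards [hτρ, hxp, hxR, hε0.eventually_lt_const (show (0 : ℝ) < 1 / 2 by norm_num)]
        with k hk h₁ h₂ h₃
      exact mem_closedBall.2 (by linarith [hk.2.2.1 (x k) h₂])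
    obtain ⟨s, -, hs⟩ := (hcpt (R + 2)).ultrafilter_le_nhds
      (U.map fun k => (τρ k).1 (x k)) (le_principal_iff.2 hmem)
    have hs' : Tendsto (fun k => (τρ k).1 (x k)) U (𝓝 s) := hs
    refine ⟨s, squeeze_zero' (Eventually.of_forall fun k =>
      mul_nonneg (hpos k).le dist_nonneg) ?_
      (g := fun k => dist ((τρ k).1 (x k)) s + 3 * (1 / ((ν k : ℝ) + 1))) ?_⟩
    · filter_upwards [hτρ, hxR, hball s] with k hk h₁ h₂
      exact hk.2.1 (x k) h₁ s h₂
    · simpa using (tendsto_iff_dist_tendsto_zero.1 hs').add hε3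

end WeakTangent

theorem exists_pair_map_ne_of_three {A B : Type*} (φ : A → B) {p u v : A} (hpu : φ p ≠ φ u)
    (hpv : φ p ≠ φ v) (huv : φ u ≠ φ v) (x : B) :
    ∃ y z : A, φ y ≠ φ z ∧ x ≠ φ y ∧ x ≠ φ z := by
  by_cases h₁ : x = φ p
  · exact ⟨u, v, huv, h₁ ▸ hpu, h₁ ▸ hpv⟩
  by_cases h₂ : x = φ u
  · exact ⟨p, v, hpv, h₁, h₂ ▸ huv⟩
  · exact ⟨p, u, hpu, h₁, h₂⟩

section UniformlyPerfect

variable {X S : Type*} [MetricSpace X] [CompactSpace X] [MetricSpace S]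

theorem diam_univ_pos_s19 [Nontrivial X] : 0 < Metric.diam (univ : Set X) := by
  obtain ⟨x, y, hxy⟩ := exists_pair_ne X
  exact (dist_pos.2 hxy).trans_le
    (dist_le_diam_of_mem isCompact_univ.isBounded (mem_univ x) (mem_univ y))

theorem UniformlyPerfect.neBot_nhdsNE [Nontrivial X] (hX : UniformlyPerfect X) (x : X) :
    (𝓝[≠] x).NeBot := by
  obtain ⟨L, hL, h⟩ := hX
  refine mem_closure_iff_nhdsWithin_neBot.1 (Metric.mem_closure_iff.2 fun ε hε => ?_)
  have hd := diam_univ_pos_s19 (X := X)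
  have hR : 0 < min (ε / 2) (Metric.diam (univ : Set X)) := by positivity
  obtain ⟨z, hz₁, hz₂⟩ := h x _ hR (min_le_right _ _)
  refine ⟨z, ?_, ?_⟩
  · rintro rfl
    exact hz₂ (mem_ball_self (by positivity))
  · rw [dist_comm]
    exact ((mem_closedBall.1 hz₁).trans (min_le_left _ _)).trans_lt (by linarith)

theorem IsRescaledLimit.exists_dist_mem_Icc [Nontrivial X] (hX : UniformlyPerfect X)
    {U : Ultrafilter ℕ} {lam : ℕ → ℝ} {σ : ℕ → S → X} {q : S}
    (h : IsRescaledLimit U lam σ q) :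
    ∃ L : ℝ, 1 ≤ L ∧ ∀ R > 0, ∃ s : S, dist s q ∈ Icc (R / L) R := by
  obtain ⟨L, hL, hX⟩ := hX
  refine ⟨L, hL, fun R hR => ?_⟩
  have hd := diam_univ_pos_s19 (X := X)
  have hex : ∀ᶠ k in (U : Filter ℕ), ∃ x : X, lam k * dist x (σ k q) ∈ Icc (R / L) R := by
    filter_upwards [h.tendsto_atTop.eventually_ge_atTop (R / Metric.diam (univ : Set X))]
      with k hk
    have hl := h.pos k
    obtain ⟨x, hx₁, hx₂⟩ := hX (σ k q) (R / lam k) (by positivity) ((div_le_comm₀ hd hl).1 hk)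
    refine ⟨x, ?_, ?_⟩
    · rw [mem_ball, not_lt, div_right_comm, div_le_iff₀ hl, mul_comm] at hx₂
      exact hx₂
    · rw [mem_closedBall, le_div_iff₀ hl, mul_comm] at hx₁
      exact hx₁
  obtain ⟨x, hx⟩ := hex.choice
  obtain ⟨s, hs⟩ := h.exists_limit x R (hx.mono fun k hk => hk.2)
  have hlim : Tendsto (fun k => lam k * dist (x k) (σ k q)) U (𝓝 (dist s q)) := by
    have h₁ := h.tendsto_dist s q
    refine (tendsto_iff_of_dist (squeeze_zero (fun _ => dist_nonneg) (fun k => ?_) hs)).2 h₁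
    rw [Real.dist_eq, ← mul_sub, abs_mul, abs_of_pos (h.pos k)]
    exact mul_le_mul_of_nonneg_left (abs_dist_sub_le _ _ _) (h.pos k).le
  exact ⟨s, ge_of_tendsto hlim (hx.mono fun k hk => hk.1),
    le_of_tendsto hlim (hx.mono fun k hk => hk.2)⟩

theorem IsRescaledLimit.exists_three_points [Nontrivial X] (hX : UniformlyPerfect X)
    {U : Ultrafilter ℕ} {lam : ℕ → ℝ} {σ : ℕ → S → X} {q : S}
    (h : IsRescaledLimit U lam σ q) : ∃ u v : S, q ≠ u ∧ q ≠ v ∧ u ≠ v := by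
  obtain ⟨L, hL, hS⟩ := h.exists_dist_mem_Icc hX
  obtain ⟨u, hu, -⟩ := hS 1 one_pos
  obtain ⟨v, hv, hv'⟩ := hS (1 / L / 2) (by positivity)
  have h₁ : 0 < 1 / L := by positivity
  refine ⟨u, v, ?_, ?_, ?_⟩
  · rintro rfl
    rw [dist_self] at hu
    linarith
  · rintro rfl
    rw [dist_self] at hv
    have : 0 < 1 / L / 2 / L := by positivity
    linarith
  · rintro rfl
    linarith

end UniformlyPerfect

section Parametrization

variable {X S : Type*} [MetricSpace X] [MetricSpace S]

theorem IsQuasiMobius.isEmbedding {η η' : NNReal ≃ₜ NNReal} {h : S → X} (hh : IsQuasiMobius η h)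
    (hinv : ∀ a b c d : S, a ≠ b → a ≠ c → a ≠ d → b ≠ c → b ≠ d → c ≠ d →
      crossRatio a b c d ≤ η' (crossRatio (h a) (h b) (h c) (h d)))
    (hS : ∀ x : S, ∃ u v : S, u ≠ v ∧ x ≠ u ∧ x ≠ v) : IsEmbedding h := by
  let e : S ≃ range h := Equiv.ofInjective h hh.1
  have he : ∀ s, (e s : X) = h s := fun _ => rfl
  have hqm : IsQuasiMobius η' e.symm := by
    refine ⟨e.symm.injective, fun a b c d h₁ h₂ h₃ h₄ h₅ h₆ => ?_⟩
    have key := hinv _ _ _ _ (e.symm.injective.ne h₁) (e.symm.injective.ne h₂)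
      (e.symm.injective.ne h₃) (e.symm.injective.ne h₄) (e.symm.injective.ne h₅)
      (e.symm.injective.ne h₆)
    simp only [← he, Equiv.apply_symm_apply] at key
    exact key
  have hcont : Continuous e.symm := hqm.continuous fun x => by
    obtain ⟨u, v, huv, hu, hv⟩ := hS (e.symm x)
    exact ⟨e u, e v, e.injective.ne huv, fun hx => hu (by simp [hx]), fun hx => hv (by simp [hx])⟩
  let E : S ≃ₜ range h := ⟨e, (hh.continuous hS).subtype_mk _, hcont⟩
  exact IsEmbedding.subtypeVal.comp E.isEmbedding

/-- A weak tangent of `X` is quasi-Möbius equivalent to the complement of a point in `X`. -/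
theorem IsRescaledLimit.exists_parametrization [CompactSpace X] [Nontrivial X]
    (hX : UniformlyPerfect X) {G : Type*} [Group G] [MulAction G X] {η : NNReal ≃ₜ NNReal}
    (hqm : ∀ g : G, IsQuasiMobius η (fun z : X => g • z)) (hcc : TriplesCocompact G X)
    {U : Ultrafilter ℕ} {lam : ℕ → ℝ} {σ : ℕ → S → X} {q : S}
    (hσ : IsRescaledLimit U lam σ q) :
    ∃ (h : S → X) (a : X), IsQuasiMobius η h ∧
      (∀ a b c d : S, a ≠ b → a ≠ c → a ≠ d → b ≠ c → b ≠ d → c ≠ d →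
        crossRatio a b c d ≤ η (crossRatio (h a) (h b) (h c) (h d))) ∧
      IsEmbedding h ∧ range h = {a}ᶜ := by
  obtain ⟨s₁, s₂, hq1, hq2, h12⟩ := hσ.exists_three_points hX
  obtain ⟨δ, hδ, hcc⟩ := hcc
  have hS := exists_pair_map_ne_of_three (id : S → S) hq1 hq2 h12
  -- representatives of distinct points are eventually distinct
  have hne : ∀ {s t : S}, s ≠ t → ∀ᶠ k in (U : Filter ℕ), σ k s ≠ σ k t := fun {s t} hst => by
    filter_upwards [(hσ.tendsto_dist s t).eventually_ne (dist_ne_zero.2 hst)] with k hk heq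
    exact hk (by rw [heq, dist_self, mul_zero])
  have hexg : ∀ᶠ k in (U : Filter ℕ), ∃ g : G, δ ≤ dist (g • σ k q) (g • σ k s₁) ∧
      δ ≤ dist (g • σ k q) (g • σ k s₂) ∧ δ ≤ dist (g • σ k s₁) (g • σ k s₂) := by
    filter_upwards [hne hq1, hne hq2, hne h12] with k h₁ h₂ h₃
    exact hcc _ _ _ h₁ h₂ h₃
  obtain ⟨g, hg⟩ := hexg.choice
  have hlim : ∀ x : ℕ → X, ∃ y, Tendsto x U (𝓝 y) := fun x => by
    obtain ⟨y, -, hy⟩ := isCompact_univ.ultrafilter_le_nhds (U.map x) (by simp)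
    exact ⟨y, hy⟩
  choose h hh using fun s => hlim fun k => g k • σ k s
  have hsep : ∀ {s t : S}, (∀ᶠ k in (U : Filter ℕ), δ ≤ dist (g k • σ k s) (g k • σ k t)) →
      h s ≠ h t := fun {s t} hst =>
    dist_pos.1 (hδ.trans_le (ge_of_tendsto ((hh s).dist (hh t)) hst))
  have hpair := exists_pair_map_ne_of_three h (hsep (hg.mono fun k hk => hk.1))
    (hsep (hg.mono fun k hk => hk.2.1)) (hsep (hg.mono fun k hk => hk.2.2))
  have hcr : ∀ a b c d : S, a ≠ d → b ≠ c →
      Tendsto (fun k => (crossRatio (σ k a) (σ k b) (σ k c) (σ k d) : ℝ)) U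
        (𝓝 (crossRatio a b c d)) := fun a b c d had hbc => by
    rw [coe_crossRatio]
    exact tendsto_crossRatio_of_scaled hσ.pos (hσ.tendsto_dist _ _) (hσ.tendsto_dist _ _)
      (hσ.tendsto_dist _ _) (hσ.tendsto_dist _ _) (dist_ne_zero.2 had) (dist_ne_zero.2 hbc)
  have hmul : ∀ a b c d : S, a ≠ b → a ≠ d → b ≠ c → c ≠ d →
      dist (h a) (h c) * dist (h b) (h d) ≤
        η (crossRatio a b c d) * (dist (h a) (h d) * dist (h b) (h c)) :=
    fun a b c d hab had hbc hcd => IsQuasiMobius.mul_le_of_tendsto (fun k => hqm (g k))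
      (hne hab) (hne had) (hne hbc) (hne hcd) (hcr a b c d had hbc) (hh a) (hh b) (hh c) (hh d)
  have hinj : Function.Injective h := fun s t hst => by
    by_contra hne'
    obtain ⟨u, v, huv, hu, hv⟩ := hpair (h s)
    have key := hmul s v u t (fun e => hv (by rw [e])) hne' (fun e => huv (by rw [e]))
      (fun e => hu (by rw [hst, e]))
    rw [hst, dist_self, zero_mul, mul_zero, ← hst] at key
    exact key.not_gt (mul_pos (dist_pos.2 hu) (dist_pos.2 hv.symm))
  have hqmh : IsQuasiMobius η h := by
    refine ⟨hinj, fun a b c d hab _ had hbc _ hcd => ?_⟩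
    rw [← NNReal.coe_le_coe, coe_crossRatio, div_le_iff₀ (mul_pos (dist_pos.2 (hinj.ne had))
      (dist_pos.2 (hinj.ne hbc)))]
    exact hmul a b c d hab had hbc hcd
  have hinv : ∀ a b c d : S, a ≠ b → a ≠ c → a ≠ d → b ≠ c → b ≠ d → c ≠ d →
      crossRatio a b c d ≤ η (crossRatio (h a) (h b) (h c) (h d)) := by
    intro a b c d hab hac had hbc hbd hcd
    refine le_of_tendsto_of_tendsto (NNReal.tendsto_coe.1 (hcr a b c d had hbc))
      ((η.continuous.tendsto _).comp ((hh a).crossRatio (hh b) (hh c) (hh d) (hinj.ne had)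
        (hinj.ne hbc))) ?_
    filter_upwards [hne hab, hne hac, hne had, hne hbc, hne hbd, hne hcd]
      with k h₁ h₂ h₃ h₄ h₅ h₆
    have hk := (hqm (g k)⁻¹).2 (g k • σ k a) (g k • σ k b) (g k • σ k c) (g k • σ k d)
      (by simpa using h₁) (by simpa using h₂) (by simpa using h₃) (by simpa using h₄)
      (by simpa using h₅) (by simpa using h₆)
    simpa using hk
  -- sequences at bounded distance from the base points have limits in the range of `h`
  have hbdd : ∀ (x : X) (R : ℝ), (∀ᶠ k in (U : Filter ℕ),
      lam k * dist ((g k)⁻¹ • x) (σ k q) ≤ R) → x ∈ range h := fun x R hx => by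
    obtain ⟨s, hs⟩ := hσ.exists_limit _ R hx
    refine ⟨s, ?_⟩
    obtain ⟨u, v, huv, hu, hv⟩ := hS s
    have hxt : ∀ t, Tendsto (fun k => lam k * dist ((g k)⁻¹ • x) (σ k t)) U
        (𝓝 (dist s t)) := fun t => by
      refine (tendsto_iff_of_dist (squeeze_zero (fun _ => dist_nonneg) (fun k => ?_) hs)).2
        (hσ.tendsto_dist s t)
      rw [Real.dist_eq, ← mul_sub, abs_mul, abs_of_pos (hσ.pos k)]
      exact mul_le_mul_of_nonneg_left (abs_dist_sub_le _ _ _) (hσ.pos k).le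
    have hxne : ∀ t, s ≠ t → ∀ᶠ k in (U : Filter ℕ), (g k)⁻¹ • x ≠ σ k t := fun t hst => by
      filter_upwards [(hxt t).eventually_ne (dist_ne_zero.2 hst)] with k hk heq
      exact hk (by rw [heq, dist_self, mul_zero])
    have hcr0 := tendsto_crossRatio_of_scaled hσ.pos hs (hσ.tendsto_dist u v) (hxt v)
      (hσ.tendsto_dist u s) (dist_ne_zero.2 hv) (dist_ne_zero.2 hu.symm)
    rw [zero_mul, zero_div] at hcr0
    have key := IsQuasiMobius.mul_le_of_tendsto (t := 0) (fun k => hqm (g k)) (hxne u hu)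
      (hxne v hv) (hne hu.symm) (hne hv) hcr0 (A := x) (by simp) (hh u) (hh s) (hh v)
    rw [η.nnreal_map_zero, NNReal.coe_zero, zero_mul] at key
    by_contra hsx
    exact key.not_gt (mul_pos (dist_pos.2 (Ne.symm hsx)) (dist_pos.2 (hinj.ne huv)))
  -- a sequence that escapes to infinity
  obtain ⟨y, hy⟩ : ∃ y : ℕ → X, Tendsto (fun k => lam k * dist (y k) (σ k q)) U atTop := by
    obtain ⟨x₁, x₂, hx⟩ := exists_pair_ne X
    have hfar : ∀ z : X, ∃ y : X, dist x₁ x₂ / 2 ≤ dist y z := fun z => by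
      by_contra! hcon
      have := dist_triangle_right x₁ x₂ z
      linarith [hcon x₁, hcon x₂]
    choose y hy using hfar
    refine ⟨fun k => y (σ k q), tendsto_atTop_mono (fun k =>
      mul_le_mul_of_nonneg_left (hy (σ k q)) (hσ.pos k).le)
      (hσ.tendsto_atTop.atTop_mul_const (half_pos (dist_pos.2 hx)))⟩
  obtain ⟨a, ha⟩ := hlim fun k => g k • y k
  have hinfty : ∀ {x : ℕ → X}, Tendsto (fun k => lam k * dist (x k) (σ k q)) U atTop →
      ∀ t, Tendsto (fun k => lam k * dist (x k) (σ k t)) U atTop := fun {x} hx t => by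
    refine tendsto_atTop_mono (fun k => ?_) (hx.atTop_add (hσ.tendsto_dist t q).neg)
    have := mul_le_mul_of_nonneg_left (dist_triangle (x k) (σ k t) (σ k q)) (hσ.pos k).le
    linarith
  have hinfne : ∀ {x : ℕ → X}, Tendsto (fun k => lam k * dist (x k) (σ k q)) U atTop →
      ∀ t, ∀ᶠ k in (U : Filter ℕ), x k ≠ σ k t := fun {x} hx t => by
    filter_upwards [(hinfty hx t).eventually_gt_atTop 0] with k hk heq
    rw [heq, dist_self, mul_zero] at hk
    exact hk.false
  -- two sequences that escape to infinity have the same limit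
  have hunique : ∀ x : X, Tendsto (fun k => lam k * dist ((g k)⁻¹ • x) (σ k q)) U atTop →
      x = a := fun x hx => by
    have hA := hinfty hx s₂
    have hB : Tendsto (fun k => lam k * dist (σ k s₁) (y k)) U atTop := by
      simpa only [dist_comm] using hinfty hy s₁
    have hD := hσ.tendsto_dist s₁ s₂
    have hcr0 : Tendsto (fun k => (crossRatio ((g k)⁻¹ • x) (σ k s₁) (y k) (σ k s₂) : ℝ)) U
        (𝓝 ((0 : NNReal) : ℝ)) := by
      have hsum := ((hD.div_atTop hB).add ((hD.div_atTop hA).mul (hD.div_atTop hB))).add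
        (hD.div_atTop hA)
      rw [mul_zero, add_zero, add_zero] at hsum
      refine squeeze_zero' (Eventually.of_forall fun k => NNReal.coe_nonneg _) ?_ hsum
      filter_upwards [hA.eventually_gt_atTop 0, hB.eventually_gt_atTop 0] with k hAk hBk
      have htri := mul_le_mul_of_nonneg_left
        (dist_triangle4 ((g k)⁻¹ • x) (σ k s₂) (σ k s₁) (y k)) (hσ.pos k).le
      have hl := hσ.pos k
      rw [dist_comm (σ k s₂), mul_add, mul_add] at htri
      rw [coe_crossRatio, ← mul_div_mul_left _ _ (mul_pos hl hl).ne', mul_mul_mul_comm,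
        mul_mul_mul_comm (lam k) (lam k)]
      generalize lam k * dist ((g k)⁻¹ • x) (σ k s₂) = A at *
      generalize lam k * dist (σ k s₁) (y k) = B at *
      have hD0 : 0 ≤ lam k * dist (σ k s₁) (σ k s₂) := by positivity
      generalize lam k * dist (σ k s₁) (σ k s₂) = D at *
      calc _ ≤ (A + D + B) * D / (A * B) := by gcongr
        _ = D / B + D / A * (D / B) + D / A := by field_simp
    have key := IsQuasiMobius.mul_le_of_tendsto (fun k => hqm (g k)) (hinfne hx s₁)
      (hinfne hx s₂) ((hinfne hy s₁).mono fun k hk => hk.symm) (hinfne hy s₂) hcr0 (A := x)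
      (by simp) (hh s₁) ha (hh s₂)
    rw [η.nnreal_map_zero, NNReal.coe_zero, zero_mul] at key
    by_contra hxa
    exact key.not_gt (mul_pos (dist_pos.2 hxa) (dist_pos.2 (hinj.ne h12)))
  refine ⟨h, a, hqmh, hinv, hqmh.isEmbedding hinv hS, Subset.antisymm ?_ fun x hx => ?_⟩
  · rintro _ ⟨s, rfl⟩ (hsa : h s = a)
    obtain ⟨u, v, huv, hu, hv⟩ := hS s
    have hy' : Tendsto (fun k => lam k * dist (σ k s) (y k)) U atTop := by
      simpa only [dist_comm] using hinfty hy s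
    have hratio : Tendsto (fun k => dist (σ k v) (y k) / dist (σ k s) (y k)) U (𝓝 1) := by
      refine tendsto_iff_dist_tendsto_zero.2 (squeeze_zero' (Eventually.of_forall fun _ =>
        dist_nonneg) ?_ ((hσ.tendsto_dist v s).div_atTop hy'))
      filter_upwards [hy'.eventually_gt_atTop 0] with k hk
      have hpos : 0 < dist (σ k s) (y k) := (pos_iff_pos_of_mul_pos hk).1 (hσ.pos k)
      rw [Real.dist_eq, div_sub_one hpos.ne', abs_div, abs_of_pos hpos,
        mul_div_mul_left _ _ (hσ.pos k).ne']
      gcongr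
      exact abs_dist_sub_le _ _ _
    have hcrt : Tendsto (fun k => (crossRatio (σ k s) (σ k v) (σ k u) (y k) : ℝ)) U
        (𝓝 (nndist s u / nndist v u : NNReal)) := by
      have hlim2 := ((hσ.tendsto_dist s u).div (hσ.tendsto_dist v u)
        (dist_ne_zero.2 huv.symm)).mul hratio
      rw [mul_one] at hlim2
      simp only [NNReal.coe_div, coe_nndist]
      refine hlim2.congr fun k => ?_
      rw [coe_crossRatio, Pi.div_apply, mul_div_mul_left _ _ (hσ.pos k).ne', div_mul_div_comm,
        mul_comm (dist (σ k v) (σ k u))]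
    have key := IsQuasiMobius.mul_le_of_tendsto (fun k => hqm (g k)) (hne hv)
      ((hinfne hy s).mono fun k hk => hk.symm) (hne huv.symm)
      ((hinfne hy u).mono fun k hk => hk.symm) hcrt (hh s) (hh v) (hh u) ha
    rw [hsa, dist_self, zero_mul, mul_zero, ← hsa] at key
    exact key.not_gt (mul_pos (dist_pos.2 (hinj.ne hu)) (dist_pos.2 (hinj.ne hv.symm)))
  · by_contra hxr
    refine hx (hunique x (Filter.tendsto_atTop.2 fun R => ?_))
    by_contra hR
    refine hxr (hbdd x R ?_)
    filter_upwards [Ultrafilter.eventually_not.2 hR] with k hk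
    exact (not_le.1 hk).le

end Parametrization

section QuasiSymmetric

/-- Comparison of the cross-ratio of a quadrilateral with its min-min version. -/
theorem min_le_mul_div_mul_of_quadrilateral {a b c e : ℝ} (ha : 0 < a) (hb : 0 < b) (hc : 0 < c)
    (he : 0 < e) (h₁ : c ≤ a + b + e) (h₂ : e ≤ a + b + c) :
    min (min a b / min c e / 3) ((min a b / min c e / 3) ^ 2) ≤ a * b / (c * e) := by
  wlog hab : a ≤ b generalizing a b
  · have := this hb ha (by linarith) (by linarith) (le_of_not_ge hab)
    rwa [min_comm b a, mul_comm b a] at this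
  wlog hce : c ≤ e generalizing c e
  · have := this he hc h₂ h₁ (le_of_not_ge hce)
    rwa [min_comm e c, mul_comm e c] at this
  rw [min_eq_left hab, min_eq_left hce]
  rcases le_total c b with hcb | hbc
  · refine (min_le_left _ _).trans ?_
    rw [div_div, div_le_div_iff₀ (by positivity) (by positivity)]
    have h : e ≤ 3 * b := by linarith
    calc a * (c * e) ≤ a * (c * (3 * b)) := by gcongr
      _ = a * b * (c * 3) := by ring
  · refine (min_le_right _ _).trans ?_
    rw [div_div, div_pow, div_le_div_iff₀ (by positivity) (by positivity)]
    have h : e ≤ 9 * c := by linarith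
    calc a ^ 2 * (c * e) ≤ a ^ 2 * (c * (9 * c)) := by gcongr
      _ = a * a * (c * 3) ^ 2 := by ring
      _ ≤ a * b * (c * 3) ^ 2 := by gcongr

theorem mul_div_mul_le_max_of_quadrilateral {a b c e : ℝ} (ha : 0 < a) (hb : 0 < b) (hc : 0 < c)
    (he : 0 < e) (h₁ : a ≤ c + e + b) (h₂ : b ≤ c + e + a) :
    a * b / (c * e) ≤ max (3 * (min a b / min c e)) ((3 * (min a b / min c e)) ^ 2) := by
  have h := min_le_mul_div_mul_of_quadrilateral hc he ha hb h₁ h₂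
  have hw : 0 < 3 * (min a b / min c e) := by positivity
  have hw' : min c e / min a b / 3 = (3 * (min a b / min c e))⁻¹ := by
    rw [mul_inv, inv_div]; ring
  rw [hw', ← inv_div (a * b), min_le_iff, inv_le_inv₀ hw (by positivity), inv_pow,
    inv_le_inv₀ (by positivity) (by positivity)] at h
  exact le_max_iff.2 h

theorem exists_homeomorph_eq {φ : NNReal → NNReal} (hφ : StrictMono φ)
    (hφ' : Function.Surjective φ) : ∃ e : NNReal ≃ₜ NNReal, ∀ x, e x = φ x :=
  ⟨(hφ.orderIsoOfSurjective φ hφ').toHomeomorph, fun _ => rfl⟩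

theorem exists_homeomorph_max_sq : ∃ e : NNReal ≃ₜ NNReal, ∀ x, e x = max x (x ^ 2) := by
  refine exists_homeomorph_eq (fun x y h => max_lt_max h (by gcongr)) fun y => ?_
  rcases le_total y 1 with h | h
  · exact ⟨y, max_eq_left (pow_le_of_le_one zero_le h two_ne_zero)⟩
  · refine ⟨NNReal.sqrt y, ?_⟩
    have h₁ : 1 ≤ NNReal.sqrt y := NNReal.one_le_sqrt.2 h
    rw [NNReal.sq_sqrt]
    refine max_eq_right ?_
    calc NNReal.sqrt y ≤ NNReal.sqrt y ^ 2 := le_self_pow h₁ two_ne_zero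
      _ = y := NNReal.sq_sqrt y

theorem exists_homeomorph_min_sq : ∃ e : NNReal ≃ₜ NNReal, ∀ x, e x = min x (x ^ 2) := by
  refine exists_homeomorph_eq (fun x y h => min_lt_min h (by gcongr)) fun y => ?_
  rcases le_total y 1 with h | h
  · refine ⟨NNReal.sqrt y, ?_⟩
    have h₁ : NNReal.sqrt y ≤ 1 := NNReal.sqrt_le_one.2 h
    rw [NNReal.sq_sqrt]
    refine min_eq_right ?_
    calc y = NNReal.sqrt y ^ 2 := (NNReal.sq_sqrt y).symm
      _ ≤ NNReal.sqrt y := pow_le_of_le_one zero_le h₁ two_ne_zero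
  · exact ⟨y, min_eq_left (le_self_pow h two_ne_zero)⟩

theorem IsQuasiSymmetric.exists_isQuasiMobius {X Y : Type*} [MetricSpace X] [MetricSpace Y]
    {ψ : NNReal ≃ₜ NNReal} {f : X → Y} (hf : IsQuasiSymmetric ψ f) :
    ∃ η : NNReal ≃ₜ NNReal, IsQuasiMobius η f := by
  obtain ⟨E, hE⟩ := exists_homeomorph_max_sq
  obtain ⟨I, hI⟩ := exists_homeomorph_min_sq
  let m₃ : NNReal ≃ₜ NNReal := Homeomorph.mulLeft₀ 3 three_ne_zero
  refine ⟨(((I.symm.trans m₃).trans ψ).trans m₃).trans E, hf.1,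
    fun x₁ x₂ x₃ x₄ h12 h13 h14 h23 h24 h34 => ?_⟩
  have hpos : ∀ {x y : X}, x ≠ y → 0 < dist x y := dist_pos.2
  have hpos' : ∀ {x y : X}, x ≠ y → 0 < dist (f x) (f y) := fun h => dist_pos.2 (hf.1.ne h)
  have hlower : min (nndist x₁ x₃) (nndist x₂ x₄) / min (nndist x₁ x₄) (nndist x₂ x₃) ≤
      3 * I.symm (crossRatio x₁ x₂ x₃ x₄) := by
    have h := min_le_mul_div_mul_of_quadrilateral (hpos h13) (hpos h24) (hpos h14) (hpos h23)
      (by linarith [dist_triangle4 x₁ x₃ x₂ x₄, dist_comm x₃ x₂])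
      (by linarith [dist_triangle4 x₂ x₄ x₁ x₃, dist_comm x₄ x₁])
    rw [← coe_crossRatio] at h
    simp only [← coe_nndist] at h
    have h' : I (min (nndist x₁ x₃) (nndist x₂ x₄) / min (nndist x₁ x₄) (nndist x₂ x₃) / 3) ≤
        crossRatio x₁ x₂ x₃ x₄ := by
      rw [hI]
      exact_mod_cast h
    have h'' := I.symm.strictMono_nnreal.monotone h'
    rwa [I.symm_apply_apply, div_le_iff₀ three_pos, mul_comm] at h''
  have hupper : crossRatio (f x₁) (f x₂) (f x₃) (f x₄) ≤
      E (3 * (min (nndist (f x₁) (f x₃)) (nndist (f x₂) (f x₄)) /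
        min (nndist (f x₁) (f x₄)) (nndist (f x₂) (f x₃)))) := by
    have h := mul_div_mul_le_max_of_quadrilateral (hpos' h13) (hpos' h24) (hpos' h14) (hpos' h23)
      (by linarith [dist_triangle4 (f x₁) (f x₄) (f x₂) (f x₃), dist_comm (f x₄) (f x₂)])
      (by linarith [dist_triangle4 (f x₂) (f x₃) (f x₁) (f x₄), dist_comm (f x₃) (f x₁)])
    rw [← coe_crossRatio] at h
    simp only [← coe_nndist] at h
    rw [hE]
    exact_mod_cast h
  have hmono := ψ.strictMono_nnreal.monotone
  have hnum : ∀ {a b a' b' c c' : NNReal}, a' / c' ≤ ψ (a / c) → b' / c' ≤ ψ (b / c) →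
      min a' b' / c' ≤ ψ (min a b / c) := fun {a b a' b' c c'} h₁ h₂ => by
    rcases le_total a b with h | h
    · rw [min_eq_left h]
      exact (by gcongr; exact min_le_left _ _ : min a' b' / c' ≤ a' / c').trans h₁
    · rw [min_eq_right h]
      exact (by gcongr; exact min_le_right _ _ : min a' b' / c' ≤ b' / c').trans h₂
  have hmin : min (nndist (f x₁) (f x₃)) (nndist (f x₂) (f x₄)) /
        min (nndist (f x₁) (f x₄)) (nndist (f x₂) (f x₃)) ≤
      ψ (min (nndist x₁ x₃) (nndist x₂ x₄) / min (nndist x₁ x₄) (nndist x₂ x₃)) := by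
    have hn : ∀ {x y : X}, x ≠ y → 0 < nndist x y := fun h => by exact_mod_cast hpos h
    have hden : 0 < min (nndist x₁ x₄) (nndist x₂ x₃) := lt_min (hn h14) (hn h23)
    rcases le_total (nndist (f x₁) (f x₄)) (nndist (f x₂) (f x₃)) with h | h
    · rw [min_eq_left h]
      refine (hnum (hf.2 x₁ x₃ x₄ h13 h14 h34) ?_).trans
        (hmono (div_le_div_of_nonneg_left zero_le hden (min_le_left _ _)))
      simpa only [nndist_comm] using hf.2 x₄ x₂ x₁ h24.symm h14.symm h12.symm
    · rw [min_eq_right h]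
      refine (hnum ?_ (hf.2 x₂ x₄ x₃ h24 h23 h34.symm)).trans
        (hmono (div_le_div_of_nonneg_left zero_le hden (min_le_right _ _)))
      simpa only [nndist_comm] using hf.2 x₃ x₁ x₂ h13.symm h23.symm h12
  refine hupper.trans (E.strictMono_nnreal.monotone (mul_le_mul_right (hmin.trans
    (hmono hlower)) 3))

end QuasiSymmetric

theorem subsingleton_of_isRescaledLimit {X S : Type*} [MetricSpace X] [MetricSpace S]
    [Subsingleton X] {U : Ultrafilter ℕ} {lam : ℕ → ℝ} {σ : ℕ → S → X} {q : S}
    (h : IsRescaledLimit U lam σ q) : Subsingleton S := by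
  refine ⟨fun s t => dist_eq_zero.1 (tendsto_nhds_unique (h.tendsto_dist s t)
    (tendsto_const_nhds.congr fun k => ?_))⟩
  rw [Subsingleton.elim (σ k s) (σ k t), dist_self, mul_zero]

/-- A continuous injection that satisfies the quasi-Möbius inequality on a dense set is quasi-Möbius. -/
theorem isQuasiMobius_of_denseRange {X Y S : Type*} [MetricSpace X] [MetricSpace Y]
    {η : NNReal ≃ₜ NNReal} {g : X → Y} (hg : Continuous g)
    (hinj : Function.Injective g) {h : S → X} (hd : DenseRange h)
    (hcr : ∀ a b c d : S, h a ≠ h b → h a ≠ h c → h a ≠ h d → h b ≠ h c → h b ≠ h d →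
      h c ≠ h d → crossRatio (g (h a)) (g (h b)) (g (h c)) (g (h d)) ≤
        η (crossRatio (h a) (h b) (h c) (h d))) : IsQuasiMobius η g := by
  refine ⟨hinj, fun a b c d hab hac had hbc hbd hcd => ?_⟩
  let L : X → Filter S := fun x => comap h (𝓝 x)
  have : ∀ x, (L x).NeBot := fun x => comap_neBot fun t ht => by
    obtain ⟨s, hs⟩ := hd.exists_mem_open isOpen_interior ⟨x, mem_interior_iff_mem_nhds.2 ht⟩
    exact ⟨s, interior_subset hs⟩
  let F := L a ×ˢ L b ×ˢ L c ×ˢ L d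
  have ha : Tendsto (fun p : S × S × S × S => h p.1) F (𝓝 a) := tendsto_comap.comp tendsto_fst
  have hb : Tendsto (fun p : S × S × S × S => h p.2.1) F (𝓝 b) :=
    tendsto_comap.comp (tendsto_fst.comp tendsto_snd)
  have hc : Tendsto (fun p : S × S × S × S => h p.2.2.1) F (𝓝 c) :=
    tendsto_comap.comp (tendsto_fst.comp (tendsto_snd.comp tendsto_snd))
  have hd : Tendsto (fun p : S × S × S × S => h p.2.2.2) F (𝓝 d) :=
    tendsto_comap.comp (tendsto_snd.comp (tendsto_snd.comp tendsto_snd))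
  have hne : ∀ {x y : X} {u v : S × S × S × S → X}, Tendsto u F (𝓝 x) → Tendsto v F (𝓝 y) →
      x ≠ y → ∀ᶠ p in F, u p ≠ v p := fun hu hv hxy =>
    ((hu.dist hv).eventually_ne (dist_ne_zero.2 hxy)).mono fun _ hp => dist_ne_zero.1 hp
  refine le_of_tendsto_of_tendsto
    (((hg.tendsto a).comp ha).crossRatio ((hg.tendsto b).comp hb) ((hg.tendsto c).comp hc)
      ((hg.tendsto d).comp hd) (hinj.ne had) (hinj.ne hbc))
    ((η.continuous.tendsto _).comp (ha.crossRatio hb hc hd had hbc)) ?_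
  filter_upwards [hne ha hb hab, hne ha hc hac, hne ha hd had, hne hb hc hbc, hne hb hd hbd,
    hne hc hd hcd] with p h₁ h₂ h₃ h₄ h₅ h₆
  exact hcr _ _ _ _ h₁ h₂ h₃ h₄ h₅ h₆

/-- **Bonk–Kleiner, Lemma 5.4.** If compact, uniformly perfect, doubling metric
spaces `X` and `Y` admit uniformly quasi-Möbius actions that are cocompact on
distinct triples, and some weak tangents of `X` and `Y` are quasi-symmetrically
homeomorphic, then `X` and `Y` are quasi-Möbius homeomorphic. -/
theorem qm_equivalence_from_qs_weak_tangents {X Y : Type*}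
    [MetricSpace X] [CompactSpace X] [MetricSpace Y] [CompactSpace Y]
    (hupX : UniformlyPerfect X) (hdbX : MetricDoubling X)
    (hupY : UniformlyPerfect Y) (hdbY : MetricDoubling Y)
    {G H : Type*} [Group G] [MulAction G X] [Group H] [MulAction H Y]
    (ηG ηH : NNReal ≃ₜ NNReal)
    (hcontG : ∀ g : G, Continuous fun z : X => g • z)
    (hqmG : ∀ g : G, IsQuasiMobius ηG (fun z : X => g • z))
    (hccG : TriplesCocompact G X)
    (hcontH : ∀ h : H, Continuous fun z : Y => h • z)
    (hqmH : ∀ h : H, IsQuasiMobius ηH (fun z : Y => h • z))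
    (hccH : TriplesCocompact H Y)
    (S T : Type*) [MetricSpace S] [MetricSpace T] (q : S) (r : T)
    (hS : PointedWeakTangent X S q) (hT : PointedWeakTangent Y T r)
    (ψ : NNReal ≃ₜ NNReal) (f : S ≃ₜ T) (hf : IsQuasiSymmetric ψ f) :
    ∃ (η' : NNReal ≃ₜ NNReal) (g : X ≃ₜ Y), IsQuasiMobius η' g := by
  obtain ⟨lamX, σX, hX⟩ := hS.exists_isRescaledLimit (hyperfilter ℕ) Nat.hyperfilter_le_atTop
  obtain ⟨lamY, σY, hY⟩ := hT.exists_isRescaledLimit (hyperfilter ℕ) Nat.hyperfilter_le_atTop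
  rcases subsingleton_or_nontrivial X with hXs | hXn
  · have hSs := subsingleton_of_isRescaledLimit hX
    have hTs : Subsingleton T := f.symm.injective.subsingleton
    have hYs : Subsingleton Y := by
      by_contra hYn
      rw [not_subsingleton_iff_nontrivial] at hYn
      obtain ⟨u, v, -, -, huv⟩ := hY.exists_three_points hupY
      exact huv (Subsingleton.elim u v)
    let g : X ≃ₜ Y :=
      { toFun := fun _ => σY 0 r
        invFun := fun _ => σX 0 q
        left_inv := fun _ => Subsingleton.elim _ _
        right_inv := fun _ => Subsingleton.elim _ _ }
    exact ⟨Homeomorph.refl _, g, g.injective, fun x₁ x₂ _ _ h => absurd (Subsingleton.elim _ _) h⟩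
  have hYn : Nontrivial Y := by
    by_contra hYn
    rw [not_nontrivial_iff_subsingleton] at hYn
    have hTs := subsingleton_of_isRescaledLimit hY
    obtain ⟨u, v, -, -, huv⟩ := hX.exists_three_points hupX
    exact huv (f.injective (Subsingleton.elim _ _))
  obtain ⟨η, hη⟩ := hf.exists_isQuasiMobius
  obtain ⟨hx, a, hxqm, hxinv, hxe, hxr⟩ := hX.exists_parametrization hupX hqmG hccG
  obtain ⟨hy, b, hyqm, -, hye, hyr⟩ := hY.exists_parametrization hupY hqmH hccH
  let eX : OnePoint S ≃ₜ X := OnePoint.equivOfIsEmbeddingOfRangeEq a hx hxe hxr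
  let eY : OnePoint T ≃ₜ Y := OnePoint.equivOfIsEmbeddingOfRangeEq b hy hye hyr
  let g : X ≃ₜ Y := (eX.symm.trans f.onePointCongr).trans eY
  have hg : ∀ s, g (hx s) = hy (f s) := fun s => by
    have hs : eX.symm (hx s) = (s : OnePoint S) := eX.symm_apply_eq.2 rfl
    simp only [g, Homeomorph.trans_apply, hs]
    rfl
  have hdense : DenseRange hx := by
    have := hupX.neBot_nhdsNE a
    rw [DenseRange, hxr]
    exact dense_compl_singleton a
  refine ⟨ηG.trans (η.trans ηH), g, isQuasiMobius_of_denseRange g.continuous g.injective hdense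
    fun s₁ s₂ s₃ s₄ h12 h13 h14 h23 h24 h34 => ?_⟩
  have hne : ∀ {s t : S}, hx s ≠ hx t → s ≠ t := fun h e => h (by rw [e])
  rw [hg, hg, hg, hg]
  exact ((hyqm.comp hη).2 s₁ s₂ s₃ s₄ (hne h12) (hne h13) (hne h14) (hne h23) (hne h24)
    (hne h34)).trans ((η.trans ηH).strictMono_nnreal.monotone (hxinv s₁ s₂ s₃ s₄ (hne h12)
      (hne h13) (hne h14) (hne h23) (hne h24) (hne h34)))
end
end
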